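/- arXiv:2109.07325 — 3 statements merged into one kernel-verified Lean document; each statement's English description precedes it below -/
import Mathlib

section
/- Let h ∈ ℤ and k ∈ ℕ with gcd(h,k)=1. Then lim_{z→0⁺} z^{3/2}·Ĥ(h/k + iz/k) (z real positive) equals: (1/(48√2))·(h/k)·ε_k^{−1} if k is odd; 0 if k ≡ 2 (mod 4); and (e^{−πi/4}/12)·ε_h·(k/h) if 4 ∣ k. -/
open scoped BigOperators

namespace HurwitzPaper

/-- Evaluation of the binary quadratic form `(a,b,c)` (i.e. `a x² + b x y + c y²`). -/
def formEval (Q : ℤ × ℤ × ℤ) (x y : ℤ) : ℤ :=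
  Q.1 * x ^ 2 + Q.2.1 * x * y + Q.2.2 * y ^ 2

/-- Discriminant `b² - 4ac` of the form `(a,b,c)`. -/
def formDisc (Q : ℤ × ℤ × ℤ) : ℤ := Q.2.1 ^ 2 - 4 * Q.1 * Q.2.2

/-- Right action of `γ ∈ SL₂(ℤ)` on a binary quadratic form: `(Q∘γ)(x,y) = Q(ax+by, cx+dy)`. -/
def formAct (γ : Matrix.SpecialLinearGroup (Fin 2) ℤ) (Q : ℤ × ℤ × ℤ) : ℤ × ℤ × ℤ :=
  (formEval Q (γ.1 0 0) (γ.1 1 0),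
   formEval Q (γ.1 0 0 + γ.1 0 1) (γ.1 1 0 + γ.1 1 1)
     - formEval Q (γ.1 0 0) (γ.1 1 0) - formEval Q (γ.1 0 1) (γ.1 1 1),
   formEval Q (γ.1 0 1) (γ.1 1 1))

/-- A form is positive definite iff its leading coefficient is positive and its
discriminant is negative. -/
def IsPosDef (Q : ℤ × ℤ × ℤ) : Prop := 0 < Q.1 ∧ formDisc Q < 0

/-- `SL₂(ℤ)`-equivalence classes of positive definite integral binary quadratic forms
of discriminant `-N`. -/
abbrev FormClasses (N : ℤ) :=
  Quot (fun (Q Q' : {Q : ℤ × ℤ × ℤ // formDisc Q = -N ∧ IsPosDef Q}) =>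
    ∃ γ : Matrix.SpecialLinearGroup (Fin 2) ℤ, formAct γ Q.1 = Q'.1)

/-- The Hurwitz class number `H(N)`: each class of positive definite forms of
discriminant `-N` is counted with weight `1/ω_Q = 2/#Γ_Q`, where `Γ_Q` is the stabilizer
of (a representative of) the class in `SL₂(ℤ)`; `H(0) = -1/12`, and `H(N) = 0` when no
such forms exist (in particular for `N < 0` and `N ≡ 1, 2 (mod 4)`). -/
noncomputable def hurwitzClassNumber (N : ℤ) : ℝ :=
  if N = 0 then -(1 / 12)
  else ∑ᶠ c : FormClasses N,
    (2 : ℝ) / (Nat.card {γ : Matrix.SpecialLinearGroup (Fin 2) ℤ //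
      formAct γ c.out.1 = c.out.1})

/-- `H_{κ,m,M}(n) = ∑_{t ≡ m (mod M)} t^κ H(4n - t²)`. -/
noncomputable def HH (κ : ℕ) (m : ℤ) (M : ℕ) (n : ℕ) : ℝ :=
  ∑ᶠ t : ℤ, if t % (M : ℤ) = m % (M : ℤ) then
    (t : ℝ) ^ κ * hurwitzClassNumber (4 * n - t ^ 2) else 0

/-- `a(n)`: the `n`-th Fourier coefficient of `η(3τ)⁸ = q ∏_{k≥1} (1-q^{3k})⁸`
(the factors with `k > n` do not affect the coefficient of `q^n`). -/
noncomputable def etaCoeff (n : ℕ) : ℤ :=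
  Polynomial.coeff (Polynomial.X * ∏ k ∈ Finset.Icc 1 n, (1 - Polynomial.X ^ (3 * k)) ^ 8 : Polynomial ℤ) n


open scoped Topology

/-- The upper incomplete gamma function `Γ(s,y) = ∫_y^∞ t^{s-1} e^{-t} dt`. -/
noncomputable def incGamma (s y : ℝ) : ℝ := ∫ t in Set.Ioi y, t ^ (s - 1) * Real.exp (-t)

/-- The completed class number generating function
`Ĥ(τ) = ∑_{n≥0} H(n)qⁿ + 1/(8π√v) + (1/(4√π)) ∑_{n≥1} n Γ(-1/2, 4πn²v) q^{-n²}`,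
regarded as a function of `τ ∈ ℂ` (with `v = Im τ`, `q = e^{2πiτ}`). -/
noncomputable def completedH (τ : ℂ) : ℂ :=
  (∑' n : ℕ, (hurwitzClassNumber (n : ℤ) : ℂ) * Complex.exp (2 * Real.pi * Complex.I * n * τ))
  + ((1 / (8 * Real.pi * Real.sqrt τ.im) : ℝ) : ℂ)
  + ((1 / (4 * Real.sqrt Real.pi) : ℝ) : ℂ) *
      ∑' n : ℕ, (((n : ℂ) + 1) *
        ((incGamma (-(1 / 2)) (4 * Real.pi * ((n : ℝ) + 1) ^ 2 * τ.im) : ℝ) : ℂ) *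
        Complex.exp (2 * Real.pi * Complex.I * (-(((n : ℂ) + 1) ^ 2)) * τ))

/-- `ε_d := 1` if `d ≡ 1 (mod 4)` and `ε_d := i` if `d ≡ 3 (mod 4)` (for `d` odd). -/
noncomputable def eps (d : ℤ) : ℂ := if d % 4 = 1 then 1 else Complex.I

section
open Filter Topology

noncomputable def gS (a : ℤ) (c : ℕ) : ℂ :=
  ∑ n ∈ Finset.range c, Complex.exp (Real.pi * Complex.I * a * (n : ℂ) ^ 2 / c)

lemma tendsto_theta_one (A : ℝ → ℂ) (hA : Tendsto (fun x => (A x).re) atTop atTop)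
    (b : ℂ) (hb : b.re = 0) :
    Tendsto (fun x => ∑' n : ℤ, Complex.exp (-Real.pi * A x * (n : ℂ) ^ 2 + 2 * Real.pi * b * n))
      atTop (𝓝 1) := by
  have key : ∀ (x : ℝ) (n : ℤ), ‖Complex.exp (-Real.pi * A x * (n : ℂ) ^ 2 + 2 * Real.pi * b * n)‖
      = Real.exp (-Real.pi * (A x).re * (n : ℝ) ^ 2) := by
    intro x n
    rw [Complex.norm_exp]
    congr 1
    have e1 : (-(Real.pi : ℂ) * A x * (n : ℂ) ^ 2 + 2 * Real.pi * b * n)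
      = ((-Real.pi * (n : ℝ) ^ 2 : ℝ) : ℂ) * A x + ((2 * Real.pi * n : ℝ) : ℂ) * b := by
      push_cast; ring
    rw [e1, Complex.add_re, Complex.re_ofReal_mul, Complex.re_ofReal_mul, hb]
    ring
  have hs : Summable (fun n : ℤ => Real.exp (-Real.pi * (n : ℝ) ^ 2)) := by
    have := (summable_jacobiTheta₂_term_iff 0 Complex.I).2 (by simp)
    refine this.norm.congr ?_
    intro n
    rw [norm_jacobiTheta₂_term]
    simp
  have h1 : (1 : ℂ) = ∑' n : ℤ, (if n = 0 then (1 : ℂ) else 0) := by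
    simp
  rw [h1]
  refine tendsto_tsum_of_dominated_convergence hs ?_ ?_
  · intro n
    by_cases hn : n = 0
    · subst hn; simp
    · simp only [hn, if_false]
      rw [tendsto_zero_iff_norm_tendsto_zero]
      simp only [key]
      refine Real.tendsto_exp_atBot.comp ?_
      have hp : 0 < Real.pi * (n : ℝ) ^ 2 := by positivity
      have := (hA.const_mul_atTop hp)
      have h2 := tendsto_neg_atTop_atBot.comp this
      refine h2.congr ?_
      intro x; simp only [Function.comp]; ring
  · filter_upwards [hA.eventually_ge_atTop 1] with x hx n
    rw [key]
    apply Real.exp_le_exp.2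
    have : 0 ≤ Real.pi * (n : ℝ) ^ 2 := by positivity
    nlinarith

lemma summable_th (a : ℤ) (c : ℕ) (A : ℂ) (hA : 0 < A.re) :
    Summable (fun n : ℤ => Complex.exp (Real.pi * Complex.I * a * (n : ℂ) ^ 2 / c
      - Real.pi * (n : ℂ) ^ 2 / A)) := by
  have him : 0 < ((a : ℂ) / c + Complex.I / A).im := by
    have : ((a : ℂ) / c).im = 0 := by
      have : ((a : ℂ) / c) = ((a / c : ℝ) : ℂ) := by push_cast; rfl
      rw [this, Complex.ofReal_im]
    rw [Complex.add_im, this, zero_add, div_eq_mul_inv, Complex.I_mul_im, Complex.inv_re]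
    have : A ≠ 0 := by rintro rfl; simp at hA
    have := Complex.normSq_pos.2 this
    positivity
  have := (summable_jacobiTheta₂_term_iff 0 _).2 him
  refine this.congr ?_
  intro n
  rw [jacobiTheta₂_term]
  congr 1
  have : A ≠ 0 := by rintro rfl; simp at hA
  field_simp
  ring_nf
  simp only [Complex.I_sq]
  ring

noncomputable def th (a : ℤ) (c : ℕ) (A : ℂ) : ℂ := ∑' n : ℤ,
  Complex.exp (Real.pi * Complex.I * a * (n : ℂ) ^ 2 / c - Real.pi * (n : ℂ) ^ 2 / A)

lemma th_eq (a : ℤ) (c : ℕ) (hc : 0 < c) (hac : Even (a * c)) (A : ℂ) (hA : 0 < A.re) :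
    th a c A = ∑ r ∈ Finset.range c, Complex.exp (Real.pi * Complex.I * a * (r : ℂ) ^ 2 / c) *
      ((A / c ^ 2) ^ (1 / 2 : ℂ) * ∑' n : ℤ, Complex.exp (-Real.pi * (A / c ^ 2) * (n : ℂ) ^ 2
        + 2 * Real.pi * (-Complex.I * (r / c)) * n)) := by
  have hA0 : A ≠ 0 := by rintro rfl; simp at hA
  have hc0 : (c : ℂ) ≠ 0 := by exact_mod_cast hc.ne'
  have : NeZero c := ⟨hc.ne'⟩
  have hs := summable_th a c A hA
  have hre : 0 < (A / c ^ 2).re := by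
    have : A / (c : ℂ) ^ 2 = ((1 / (c : ℝ) ^ 2 : ℝ) : ℂ) * A := by push_cast; field_simp
    rw [this, Complex.re_ofReal_mul]; positivity
  rw [th, ← (Int.divModEquiv c).symm.tsum_eq]
  have hs2 : Summable (fun p : ℤ × Fin c => Complex.exp (Real.pi * Complex.I * a *
      (((Int.divModEquiv c).symm p : ℤ) : ℂ) ^ 2 / c
      - Real.pi * (((Int.divModEquiv c).symm p : ℤ) : ℂ) ^ 2 / A)) :=
    (Int.divModEquiv c).symm.summable_iff.2 hs
  rw [hs2.tsum_prod' ?_, Summable.tsum_comm ?_, tsum_fintype,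
    ← Fin.sum_univ_eq_sum_range (fun r => Complex.exp (Real.pi * Complex.I * a * (r : ℂ) ^ 2 / c) *
      ((A / c ^ 2) ^ (1 / 2 : ℂ) * ∑' n : ℤ, Complex.exp (-Real.pi * (A / c ^ 2) * (n : ℂ) ^ 2
        + 2 * Real.pi * (-Complex.I * (r / c)) * n)))]
  · refine Finset.sum_congr rfl ?_
    intro r _
    rw [Complex.tsum_exp_neg_quadratic hre, ← mul_assoc ((A / c ^ 2) ^ (1 / 2 : ℂ)), mul_one_div_cancel,
      one_mul, ← tsum_mul_left]
    · refine tsum_congr ?_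
      intro n
      simp only [Int.divModEquiv_symm_apply]
      rw [← Complex.exp_add]
      obtain ⟨m, hm⟩ := hac
      have hm' : (a : ℂ) * c = m + m := by exact_mod_cast congrArg (Int.cast : ℤ → ℂ) hm
      rw [Complex.exp_eq_exp_iff_exists_int]
      refine ⟨m * n ^ 2 + a * n * (r : ℕ), ?_⟩
      push_cast
      have : (a : ℂ) = (m + m) / c := by field_simp; rw [hm']; ring
      rw [this]
      field_simp
      ring_nf
      simp only [Complex.I_sq, Complex.I_pow_four]
      ring
    · intro h
      rw [Complex.cpow_eq_zero_iff] at h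
      exact (by rw [h.1] at hre; simp at hre)
  · exact (Equiv.prodComm _ _).summable_iff.2 hs2
  · intro n
    exact (hasSum_fintype _).summable

end

section
open Filter Topology

lemma half_cpow (r : ℝ) (hr : 0 < r) (x : ℂ) (hx : x ≠ 0) :
    ((r : ℂ) * x) ^ (1 / 2 : ℂ) = (Real.sqrt r : ℂ) * x ^ (1 / 2 : ℂ) := by
  have hrx : (r : ℂ) * x ≠ 0 := mul_ne_zero (by exact_mod_cast hr.ne') hx
  rw [Complex.cpow_def_of_ne_zero hrx, Complex.cpow_def_of_ne_zero hx, Complex.log_ofReal_mul hr hx,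
    add_mul, Complex.exp_add]
  congr 1
  rw [Real.sqrt_eq_rpow, Real.rpow_def_of_pos hr]
  push_cast
  rfl

lemma th_tendsto (a : ℤ) (c : ℕ) (hc : 0 < c) (hac : Even (a * c)) (A : ℝ → ℂ)
    (hA : Tendsto (fun x => (A x).re) atTop atTop) :
    Tendsto (fun x => th a c (A x) / (A x) ^ (1 / 2 : ℂ)) atTop (𝓝 (gS a c / c)) := by
  have hc' : (0 : ℝ) < c := by exact_mod_cast hc
  have hc0 : (c : ℂ) ≠ 0 := by exact_mod_cast hc.ne'
  have hA2 : Tendsto (fun x => (A x / (c : ℂ) ^ 2).re) atTop atTop := by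
    have := hA.const_mul_atTop (show 0 < 1 / (c : ℝ) ^ 2 by positivity)
    refine this.congr ?_
    intro x
    have : A x / (c : ℂ) ^ 2 = ((1 / (c : ℝ) ^ 2 : ℝ) : ℂ) * A x := by push_cast; field_simp
    rw [this, Complex.re_ofReal_mul]
  have hlim : Tendsto (fun x => ∑ r ∈ Finset.range c,
      Complex.exp (Real.pi * Complex.I * a * (r : ℂ) ^ 2 / c) * ((1 / (c : ℂ)) *
        ∑' n : ℤ, Complex.exp (-Real.pi * (A x / c ^ 2) * (n : ℂ) ^ 2
        + 2 * Real.pi * (-Complex.I * (r / c)) * n))) atTop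
      (𝓝 (∑ r ∈ Finset.range c,
      Complex.exp (Real.pi * Complex.I * a * (r : ℂ) ^ 2 / c) * ((1 / (c : ℂ)) * 1))) := by
    refine tendsto_finsetSum _ ?_
    intro r _
    refine ((tendsto_theta_one _ hA2 _ ?_).const_mul _).const_mul _
    have : -Complex.I * ((r : ℂ) / c) = ((r / c : ℝ) : ℂ) * -Complex.I := by push_cast; ring
    rw [this, Complex.re_ofReal_mul]; simp
  have e : gS a c / c = ∑ r ∈ Finset.range c,
      Complex.exp (Real.pi * Complex.I * a * (r : ℂ) ^ 2 / c) * ((1 / (c : ℂ)) * 1) := by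
    rw [gS, Finset.sum_div]
    refine Finset.sum_congr rfl fun r _ => by ring
  rw [e]
  refine hlim.congr' ?_
  filter_upwards [hA.eventually_gt_atTop 0] with x hx
  have hA0 : A x ≠ 0 := by intro h; rw [h] at hx; simp at hx
  have h2 : (A x / (c : ℂ) ^ 2) ^ (1 / 2 : ℂ) = (1 / c) * (A x) ^ (1 / 2 : ℂ) := by
    have : A x / (c : ℂ) ^ 2 = ((1 / (c : ℝ) ^ 2 : ℝ) : ℂ) * A x := by push_cast; field_simp
    rw [this, half_cpow _ (by positivity) _ hA0, Real.sqrt_div (by norm_num), Real.sqrt_sq hc'.le]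
    push_cast; simp
  have h3 : (A x) ^ (1 / 2 : ℂ) ≠ 0 := by
    intro h; rw [Complex.cpow_eq_zero_iff] at h; exact hA0 h.1
  rw [th_eq a c hc hac _ hx, Finset.sum_div, h2]
  refine Finset.sum_congr rfl fun r _ => ?_
  field_simp

lemma th_jacobi (a : ℤ) (c : ℕ) (A τ : ℂ) (h : τ = (a : ℂ) / c + Complex.I / A) :
    th a c A = jacobiTheta₂ 0 τ := by
  subst h
  rw [th, jacobiTheta₂]
  refine tsum_congr fun n => ?_
  rw [jacobiTheta₂_term]
  congr 1
  have : Complex.I * (Complex.I / A) = - 1 / A := by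
    rw [← mul_div_assoc, Complex.I_mul_I]
  rw [show (2 * Real.pi * Complex.I * n * 0 + Real.pi * Complex.I * n ^ 2 * (a / c + Complex.I / A) : ℂ)
    = Real.pi * Complex.I * a * (n : ℂ) ^ 2 / c + Real.pi * n ^ 2 * (Complex.I * (Complex.I / A)) by ring,
    this]
  ring

lemma gS_recip (a c : ℕ) (ha : 0 < a) (hc : 0 < c) (hac : Even ((a : ℤ) * c)) :
    gS a c = Complex.exp (Real.pi * Complex.I / 4) * (Real.sqrt (c / a) : ℂ) * gS (-(c : ℤ)) a := by
  have ha' : (0 : ℝ) < a := by exact_mod_cast ha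
  have hc' : (0 : ℝ) < c := by exact_mod_cast hc
  have ha0 : (a : ℂ) ≠ 0 := by exact_mod_cast ha.ne'
  have hc0 : (c : ℂ) ≠ 0 := by exact_mod_cast hc.ne'
  set B : ℝ → ℂ := fun x => ((x : ℝ) : ℂ)⁻¹ with hB
  have hB0 : Tendsto B atTop (𝓝 0) := by
    have := (Complex.continuous_ofReal.tendsto 0).comp tendsto_inv_atTop_zero
    simpa [Function.comp_def, hB] using this
  set W : ℝ → ℂ := fun x => ((a : ℂ) / c) ^ 2 + Complex.I * a / c * B x with hW
  have hWt : Tendsto W atTop (𝓝 (((a : ℂ) / c) ^ 2)) := by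
    have := (hB0.const_mul (Complex.I * a / c)).const_add (((a : ℂ) / c) ^ 2)
    simpa using this
  have hWt2 : Tendsto (fun x => (W x) ^ (1 / 2 : ℂ)) atTop (𝓝 ((a : ℂ) / c)) := by
    have e : ((a : ℂ) / c) = (((a : ℂ) / c) ^ 2) ^ (1 / 2 : ℂ) := by
      have : (((a : ℂ) / c) ^ 2) = (((a / c : ℝ) ^ 2 : ℝ) : ℂ) * 1 := by push_cast; ring
      rw [this, half_cpow _ (by positivity) _ one_ne_zero, Real.sqrt_sq (by positivity)]
      simp
    conv_rhs => rw [e]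
    refine hWt.cpow tendsto_const_nhds ?_
    left
    have : (((a : ℂ) / c) ^ 2) = (((a / c : ℝ) ^ 2 : ℝ) : ℂ) := by push_cast; ring
    rw [this, Complex.ofReal_re]; positivity
  have hxt : Tendsto (fun x : ℝ => ((x : ℂ)).re) atTop atTop := by simp only [Complex.ofReal_re]; exact tendsto_id
  have hAt : Tendsto (fun x : ℝ => ((x : ℂ) * W x).re) atTop atTop := by
    have h1 := tendsto_id.const_mul_atTop (show 0 < ((a : ℝ) / c) ^ 2 by positivity)
    refine h1.congr' ?_
    filter_upwards [eventually_gt_atTop 0] with x hx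
    rw [Complex.re_ofReal_mul]
    simp only [hW, hB, id]
    have : (((a : ℂ) / c) ^ 2) = (((a / c : ℝ) ^ 2 : ℝ) : ℂ) := by push_cast; ring
    have h2 : Complex.I * a / c * (x : ℂ)⁻¹ = ((a / c * x⁻¹ : ℝ) : ℂ) * Complex.I := by push_cast; ring
    rw [this, h2, Complex.add_re, Complex.re_ofReal_mul, Complex.ofReal_re]
    simp; ring
  have L1 := th_tendsto a c hc hac (fun x => (x : ℂ)) hxt
  have L2 := th_tendsto (-(c : ℤ)) a ha (by rw [neg_mul, mul_comm]; exact hac.neg) _ hAt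
  have hτ : Tendsto (fun x => (-Complex.I * ((a : ℂ) / c + Complex.I * B x)) ^ (1 / 2 : ℂ)) atTop
      (𝓝 ((Real.sqrt (a / c) : ℂ) * Complex.exp (-(Real.pi * Complex.I / 4)))) := by
    have e : (Real.sqrt (a / c) : ℂ) * Complex.exp (-(Real.pi * Complex.I / 4))
        = (-Complex.I * ((a : ℂ) / c)) ^ (1 / 2 : ℂ) := by
      have : -Complex.I * ((a : ℂ) / c) = ((a / c : ℝ) : ℂ) * -Complex.I := by push_cast; ring
      rw [this, half_cpow _ (by positivity) _ (by simp), Complex.cpow_def_of_ne_zero (by simp),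
        Complex.log_neg_I]
      congr 2; ring
    rw [e]
    have h1 : Tendsto (fun x => (-Complex.I * ((a : ℂ) / c + Complex.I * B x))) atTop
        (𝓝 (-Complex.I * ((a : ℂ) / c))) := by
      have := ((hB0.const_mul Complex.I).const_add ((a : ℂ) / c)).const_mul (-Complex.I)
      simpa using this
    refine h1.cpow tendsto_const_nhds ?_
    right
    have : -Complex.I * ((a : ℂ) / c) = ((a / c : ℝ) : ℂ) * -Complex.I := by push_cast; ring
    rw [this, Complex.im_ofReal_mul]
    simp; exact ⟨ha.ne', hc.ne'⟩
  have hne : (Real.sqrt (a / c) : ℂ) * Complex.exp (-(Real.pi * Complex.I / 4)) ≠ 0 := by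
    refine mul_ne_zero ?_ (Complex.exp_ne_zero _)
    have : 0 < Real.sqrt (a / c) := Real.sqrt_pos.2 (by positivity)
    exact_mod_cast this.ne'
  have L3 := (L2.mul hWt2).div hτ hne
  have L4 := tendsto_nhds_unique_of_eventuallyEq L1 L3 ?_
  · have e1 : (Real.sqrt (c / a) : ℂ) * (Real.sqrt (a / c) : ℂ) = 1 := by
      rw [← Complex.ofReal_mul, ← Real.sqrt_mul (by positivity)]
      rw [div_mul_div_cancel₀ ha'.ne', div_self hc'.ne']; simp
    have e2 : Complex.exp (Real.pi * Complex.I / 4) * Complex.exp (-(Real.pi * Complex.I / 4)) = 1 := by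
      rw [← Complex.exp_add]; simp
    have h5 : gS a c = gS (-(c : ℤ)) a / ((Real.sqrt (a / c) : ℂ) * Complex.exp (-(Real.pi * Complex.I / 4))) := by
      rw [div_eq_iff hc0] at L4
      rw [L4]; field_simp
    rw [h5, div_eq_iff hne]
    linear_combination (-(gS (-(c : ℤ)) a)) * e1 * (Complex.exp (Real.pi * Complex.I / 4) * Complex.exp (-(Real.pi * Complex.I / 4))) - gS (-(c : ℤ)) a * e2
  · filter_upwards [eventually_gt_atTop 0, hAt.eventually_gt_atTop 0] with x hx hx2
    have hx0 : (x : ℂ) ≠ 0 := by exact_mod_cast hx.ne'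
    have hW0 : W x ≠ 0 := by intro h; rw [h] at hx2; simp at hx2
    have hτ0 : (a : ℂ) / c + Complex.I * B x ≠ 0 := by
      intro h
      apply hW0
      simp only [hW]
      linear_combination ((a : ℂ) / c) * h
    have hs : (Real.sqrt x : ℂ) ≠ 0 := by exact_mod_cast (Real.sqrt_pos.2 hx).ne'
    have e1 : ((x : ℂ)) ^ (1 / 2 : ℂ) = Real.sqrt x := by
      have := half_cpow x hx 1 one_ne_zero
      simpa using this
    have hWh : (W x) ^ (1 / 2 : ℂ) ≠ 0 := by
      intro h; rw [Complex.cpow_eq_zero_iff] at h; exact hW0 h.1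
    simp only [Pi.mul_apply, Pi.div_apply]
    rw [half_cpow x hx _ hW0, e1, th_jacobi a c x ((a : ℂ) / c + Complex.I * B x) (by simp [hB]; ring),
      th_jacobi (-(c : ℤ)) a (x * W x) (-1 / ((a : ℂ) / c + Complex.I * B x)) ?_,
      jacobiTheta₂_functional_equation]
    · simp
      field_simp
    · have hac0 : (a : ℂ) * x + Complex.I * c ≠ 0 := by
        intro h; apply hτ0
        simp only [hB]
        field_simp
        linear_combination h
      have e3 : x * W x = (a / c) * ((a * x + Complex.I * c) / c) := by
        simp only [hW, hB]; field_simp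
      have e4 : (a : ℂ) / c + Complex.I * B x = (a * x + Complex.I * c) / (c * x) := by
        simp only [hB]; field_simp
      rw [e3, e4]
      push_cast
      field_simp
      ring

end

section
open Filter Topology

lemma gS_add (a : ℤ) (c : ℕ) (hc : 0 < c) (m : ℤ) : gS (a + 2 * c * m) c = gS a c := by
  have hc0 : (c : ℂ) ≠ 0 := by exact_mod_cast hc.ne'
  refine Finset.sum_congr rfl fun n _ => ?_
  rw [Complex.exp_eq_exp_iff_exists_int]
  refine ⟨m * n ^ 2, ?_⟩
  push_cast
  field_simp

lemma gS_neg (a : ℤ) (c : ℕ) : gS (-a) c = (starRingEnd ℂ) (gS a c) := by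
  rw [gS, gS, map_sum]
  refine Finset.sum_congr rfl fun n _ => ?_
  rw [← Complex.exp_conj]
  congr 1
  simp

noncomputable def gR (a : ℤ) (c : ℕ) : ℂ :=
  if c % 2 = 1 then (Real.sqrt c : ℂ) * (jacobiSym a c : ℂ) * Complex.exp (Real.pi * Complex.I * (1 - c) / 4)
  else (Real.sqrt c : ℂ) * (jacobiSym c a.natAbs : ℂ) * Complex.exp (Real.pi * Complex.I * a / 4)

lemma exp_shift (x : ℂ) (n : ℤ) : Complex.exp (x + Real.pi * Complex.I * n) =
    (-1) ^ n.natAbs * Complex.exp x := by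
  rw [Complex.exp_add, mul_comm]
  congr 1
  rw [mul_comm, Complex.exp_int_mul, Complex.exp_pi_mul_I]
  obtain ⟨m, rfl | rfl⟩ := n.eq_nat_or_neg
  · simp
  · rw [zpow_neg, zpow_natCast, ← inv_pow]
    norm_num

lemma gR_neg (a : ℤ) (c : ℕ) : gR (-a) c = (starRingEnd ℂ) (gR a c) := by
  rw [gR, gR]
  split_ifs with h
  · have hodd : Odd c := Nat.odd_iff.2 h
    rw [neg_eq_neg_one_mul, jacobiSym.mul_left, jacobiSym.at_neg_one hodd, ZMod.χ₄_nat_eq_if_mod_four]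
    simp only [map_mul, Complex.conj_ofReal, ← Complex.exp_conj, map_div₀, map_sub, Complex.conj_I,
      map_one, map_natCast, map_intCast, Complex.conj_ofNat]
    have hh : c % 4 = 1 ∨ c % 4 = 3 := by omega
    have e : ∀ n : ℕ, c = 2 * n + 1 → Complex.exp (Real.pi * -Complex.I * (1 - c) / 4) =
       (-1) ^ n * Complex.exp (Real.pi * Complex.I * (1 - c) / 4) := by
      intro n hn
      have := exp_shift (Real.pi * Complex.I * (1 - c) / 4) n
      simp only [Int.natAbs_natCast, Int.cast_natCast] at this
      rw [← this, hn]
      congr 1; push_cast; ring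
    rcases hh with h4 | h4
    · rw [e (2 * (c / 4)) (by omega), pow_mul]
      simp [h4, h]
    · rw [e (2 * (c / 4) + 1) (by omega), pow_succ, pow_mul]
      simp [h4, h]
  · simp only [map_mul, Complex.conj_ofReal, ← Complex.exp_conj, map_div₀, Complex.conj_I,
      map_intCast, Complex.conj_ofNat, Int.natAbs_neg]
    congr 2; push_cast; ring

lemma gR_recip (a c : ℕ) (ha : 0 < a) (hc : 0 < c) (hac : Even ((a : ℤ) * c)) (hco : Nat.Coprime a c) :
    gR a c = Complex.exp (Real.pi * Complex.I / 4) * (Real.sqrt (c / a) : ℂ) * gR (-(c : ℤ)) a := by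
  have hs : (Real.sqrt (c / a) : ℂ) * (Real.sqrt a : ℂ) = Real.sqrt c := by
    rw [← Complex.ofReal_mul, ← Real.sqrt_mul (by positivity)]
    congr 2
    have : (a : ℝ) ≠ 0 := by exact_mod_cast ha.ne'
    field_simp
  have hpar : (c % 2 = 1 ∧ a % 2 = 0) ∨ (c % 2 = 0 ∧ a % 2 = 1) := by
    rcases Nat.mod_two_eq_zero_or_one a with h1 | h1 <;> rcases Nat.mod_two_eq_zero_or_one c with h2 | h2
    · exfalso
      have := Nat.dvd_gcd (Nat.dvd_of_mod_eq_zero h1) (Nat.dvd_of_mod_eq_zero h2)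
      rw [hco] at this; omega
    · omega
    · omega
    · exfalso
      rw [Int.even_mul] at hac
      rcases hac with h | h
      · have := Int.even_iff.1 h; omega
      · have := Int.even_iff.1 h; omega
  rcases hpar with ⟨h1, h2⟩ | ⟨h1, h2⟩
  · rw [gR, gR, if_pos h1, if_neg (by omega), ← hs]
    have : Complex.exp (Real.pi * Complex.I * (1 - c) / 4) = Complex.exp (Real.pi * Complex.I / 4) *
      Complex.exp (Real.pi * Complex.I * ((-(c : ℤ) : ℤ) : ℂ) / 4) := by
      rw [← Complex.exp_add]; congr 1; push_cast; ring
    rw [this, Int.natAbs_neg, Int.natAbs_natCast]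
    ring
  · rw [gR_neg, gR, gR, if_neg (by omega), if_pos h2, ← hs]
    simp only [map_mul, Complex.conj_ofReal, ← Complex.exp_conj, map_div₀, map_sub, Complex.conj_I,
      map_one, map_natCast, map_intCast, Complex.conj_ofNat]
    have : Complex.exp (Real.pi * Complex.I * (a : ℤ) / 4) = Complex.exp (Real.pi * Complex.I / 4) *
      Complex.exp (Real.pi * -Complex.I * (1 - a) / 4) := by
      rw [← Complex.exp_add]; congr 1; push_cast; ring
    rw [this, Int.natAbs_natCast]
    ring

lemma jac_shift (d a b : ℕ) (ha : Odd a) (hd : 0 < d) (hb : b = a + 4 * d ∨ b + a = 4 * d) :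
    jacobiSym ((2 * d : ℕ) : ℤ) b = (-1) ^ d * jacobiSym ((2 * d : ℕ) : ℤ) a := by
  have hbo : Odd b := by
    rw [Nat.odd_iff] at *; omega
  have h1 : jacobiSym (d : ℤ) b = jacobiSym (d : ℤ) a := by
    rcases hb with hb | hb
    · rw [jacobiSym.mod_right' d hbo, jacobiSym.mod_right' d ha, hb]; simp
    · have hodd : Odd ((4 * d - 1) * a) := by
        refine Odd.mul ?_ ha
        rw [Nat.odd_iff]; omega
      have hmod : b % (4 * d) = ((4 * d - 1) * a) % (4 * d) := by
        have : b ≡ (4 * d - 1) * a [MOD 4 * d] := by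
          rw [← Int.natCast_modEq_iff, Int.modEq_iff_dvd]
          refine ⟨a - 1, ?_⟩
          have e1 : ((4 * d - 1 : ℕ) : ℤ) = 4 * d - 1 := by omega
          have e2 : (b : ℤ) = 4 * d - a := by omega
          push_cast [e1, e2]; ring
        exact this
      rw [jacobiSym.mod_right' d hbo, hmod, ← jacobiSym.mod_right' d hodd, jacobiSym.mul_right']
      · have : jacobiSym (d : ℤ) (4 * d - 1) = 1 := by
          have hcop : Nat.Coprime 2 (4 * d - 1) := by
            rw [Nat.coprime_two_left, Nat.odd_iff]; omega
          have h4 : jacobiSym ((2 : ℕ) ^ 2 : ℤ) (4 * d - 1) = 1 := by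
            refine jacobiSym.sq_one' ?_
            rw [Int.gcd_natCast_natCast]; exact hcop
          have : jacobiSym ((2 : ℕ) ^ 2 * d : ℤ) (4 * d - 1) = 1 := by
            rw [jacobiSym.mod_left]
            have : (((2 : ℕ) : ℤ) ^ 2 * d) % ((4 * d - 1 : ℕ) : ℤ) = 1 % ((4 * d - 1 : ℕ) : ℤ) := by
              have e1 : ((4 * d - 1 : ℕ) : ℤ) = 4 * d - 1 := by omega
              rw [e1]
              refine Int.ModEq.symm ((Int.modEq_iff_dvd).2 ⟨1, by push_cast; ring⟩)
            rw [this, ← jacobiSym.mod_left, jacobiSym.one_left]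
          rw [jacobiSym.mul_left, h4, one_mul] at this
          exact this
        rw [this, one_mul]
      · omega
      · rintro rfl; simp at ha
  have h2 : jacobiSym 2 b = (-1) ^ d * jacobiSym 2 a := by
    rw [jacobiSym.at_two hbo, jacobiSym.at_two ha, ZMod.χ₈_nat_eq_if_mod_eight,
      ZMod.χ₈_nat_eq_if_mod_eight]
    rw [Nat.odd_iff] at ha hbo
    rcases Nat.even_or_odd d with hd2 | hd2
    · rw [hd2.neg_one_pow]
      rw [Nat.even_iff] at hd2
      split_ifs <;> first | omega | rfl
    · rw [hd2.neg_one_pow]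
      rw [Nat.odd_iff] at hd2
      split_ifs <;> first | omega | rfl
  push_cast
  rw [jacobiSym.mul_left, jacobiSym.mul_left, h1, h2]
  ring

lemma gR_sub (a : ℤ) (c : ℕ) (hc : 0 < c) (ha : (c : ℤ) < a) (hpar : c % 2 = 0 → a % 2 = 1) :
    gR (a - 2 * c) c = gR a c := by
  rw [gR, gR]
  split_ifs with h
  · rw [jacobiSym.mod_left, Int.sub_mul_emod_self_right, ← jacobiSym.mod_left]
  · obtain ⟨d, rfl⟩ : ∃ d, c = 2 * d := ⟨c / 2, by omega⟩
    have hao := hpar (by omega)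
    have key : jacobiSym ((2 * d : ℕ) : ℤ) (a - 2 * (2 * d : ℕ)).natAbs =
        (-1) ^ d * jacobiSym ((2 * d : ℕ) : ℤ) a.natAbs := by
      by_cases h2 : 4 * (d : ℤ) ≤ a
      · have := jac_shift d (a - 2 * (2 * d : ℕ)).natAbs a.natAbs (by rw [Nat.odd_iff]; omega) (by omega)
          (by left; omega)
        rw [this, ← mul_assoc, ← mul_pow]; simp
      · exact jac_shift d a.natAbs (a - 2 * (2 * d : ℕ)).natAbs (by rw [Nat.odd_iff]; omega) (by omega)
          (by right; omega)
    have e : Complex.exp (Real.pi * Complex.I * ((a - 2 * (2 * d : ℕ) : ℤ) : ℂ) / 4) =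
       (-1) ^ d * Complex.exp (Real.pi * Complex.I * a / 4) := by
      have := exp_shift (Real.pi * Complex.I * a / 4) (-d)
      simp only [Int.natAbs_neg, Int.natAbs_natCast] at this
      rw [← this]
      congr 1; push_cast; ring
    rw [key, e]
    push_cast
    have : ((-1 : ℂ) ^ d) * (-1) ^ d = 1 := by rw [← mul_pow]; simp
    linear_combination (Real.sqrt (2 * d) : ℂ) * (jacobiSym (2 * d) a.natAbs : ℂ) * Complex.exp (Real.pi * Complex.I * a / 4) * this

theorem gS_eq_gR (N : ℕ) : ∀ (a : ℤ) (c : ℕ), 2 * c + a.natAbs = N → 0 < c → Even (a * c) →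
    Int.gcd a c = 1 → gS a c = gR a c := by
  induction N using Nat.strong_induction_on with
  | _ N ih =>
  have pos : ∀ (a : ℤ) (c : ℕ), 0 < a → 2 * c + a.natAbs = N → 0 < c → Even (a * c) →
    Int.gcd a c = 1 → gS a c = gR a c := by
    intro a c ha hN hc hac hco
    have hcc : c % 2 = 0 → a % 2 = 1 := by
      intro h
      by_contra h2
      have : (2 : ℤ) ∣ (Int.gcd a c : ℤ) := Int.dvd_coe_gcd (by omega) (by omega)
      rw [hco] at this; omega
    rcases lt_trichotomy a c with h | h | h
    · lift a to ℕ using ha.le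
      have ha' : 0 < a := by omega
      rw [gS_recip a c ha' hc hac, gR_recip a c ha' hc hac (by simpa using hco)]
      congr 1
      refine ih (2 * a + c) (by simp at hN; omega) _ _ (by simp) ha' ?_ ?_
      · rw [neg_mul, mul_comm]; exact hac.neg
      · rw [Int.gcd_comm]; simpa using hco
    · exfalso
      rw [h] at hco
      have : c = 1 := by simpa using hco
      subst this
      rw [h] at hac
      exact absurd hac (by decide)
    · rw [← gR_sub a c hc h hcc, ← gS_add a c hc (-1)]
      have e : a + 2 * (c : ℤ) * -1 = a - 2 * c := by ring
      rw [e]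
      refine ih _ ?_ _ _ rfl hc ?_ ?_
      · omega
      · rw [sub_mul]
        refine hac.sub ?_
        rw [mul_assoc]; exact even_two_mul _
      · rw [← hco]
        have := Int.gcd_add_mul_left_left (c : ℤ) a (-2)
        rw [← e]
        convert this using 2; ring
  intro a c hN hc hac hco
  rcases lt_trichotomy a 0 with h | h | h
  · have := pos (-a) c (by omega) (by simpa using hN) hc (by rw [neg_mul]; exact hac.neg) (by simpa using hco)
    rw [gS_neg, gR_neg] at this
    exact (starRingEnd ℂ).injective this
  · subst h
    have : c = 1 := by simpa using hco
    subst this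
    simp [gS, gR]
  · exact pos a c h hN hc hac hco

end

section
open Filter Topology

/-- the Gauss sum in the average -/
noncomputable def gG (h : ℤ) (k : ℕ) : ℂ :=
  ∑ b ∈ Finset.range k, Complex.exp (2 * Real.pi * Complex.I * (-(h * (b : ℂ) ^ 2)) / k)

lemma exp_pi_int (n : ℤ) : Complex.exp (Real.pi * Complex.I * n) = (-1) ^ n.natAbs := by
  have := exp_shift 0 n
  simpa using this

lemma gG_odd (h : ℤ) (k : ℕ) (hk : k % 2 = 1) (hco : Int.gcd h k = 1) :
    gG h k = (Real.sqrt k : ℂ) * (jacobiSym h k : ℂ) * (eps (k : ℤ))⁻¹ := by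
  have hodd : Odd k := Nat.odd_iff.2 hk
  have e1 : gG h k = gS (-2 * h) k := by
    refine Finset.sum_congr rfl fun b _ => ?_
    congr 1; push_cast; ring
  have hc2 : Int.gcd (-2 * h) k = 1 := by
    rw [← Int.isCoprime_iff_gcd_eq_one] at *
    refine IsCoprime.mul_left ?_ hco
    rw [IsCoprime.neg_left_iff, Int.isCoprime_iff_gcd_eq_one]
    have := (Nat.coprime_two_left (n := k)).2 hodd
    exact_mod_cast this
  rw [e1, gS_eq_gR _ _ _ rfl (by omega) (by rw [mul_assoc]; exact (even_two.neg).mul_right _) hc2, gR, if_pos hk,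
    jacobiSym.mul_left]
  suffices hm : (jacobiSym (-2) k : ℂ) * Complex.exp (Real.pi * Complex.I * (1 - k) / 4) = (eps (k : ℤ))⁻¹ by
    rw [← hm]; push_cast; ring
  rw [show (-2 : ℤ) = -1 * 2 by norm_num, jacobiSym.mul_left, jacobiSym.at_neg_one hodd,
    jacobiSym.at_two hodd, ZMod.χ₄_nat_eq_if_mod_four, ZMod.χ₈_nat_eq_if_mod_eight]
  have key : ∀ n : ℤ, ∀ j : ℤ, (1 - k : ℤ) = 4 * n - 2 * j → Complex.exp (Real.pi * Complex.I * (1 - k) / 4) =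
      (-1) ^ n.natAbs * Complex.exp (-(Real.pi / 2 * Complex.I)) ^ j := by
    intro n j hn
    rw [← exp_pi_int, ← Complex.exp_int_mul, ← Complex.exp_add]
    congr 1
    have : (1 - k : ℂ) = 4 * n - 2 * j := by exact_mod_cast congrArg (Int.cast : ℤ → ℂ) hn
    rw [this]; ring
  have hI : Complex.exp (-(Real.pi / 2 * Complex.I)) = -Complex.I := by
    rw [Complex.exp_neg, Complex.exp_pi_div_two_mul_I]; simp
  rw [hI] at key
  have h8 : k % 8 = 1 ∨ k % 8 = 3 ∨ k % 8 = 5 ∨ k % 8 = 7 := by omega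
  rcases h8 with h8 | h8 | h8 | h8
  · have h4 : k % 4 = 1 := by omega
    have h4' : (k : ℤ) % 4 = 1 := by omega
    rw [key (-(2 * (k / 8 : ℕ) : ℕ)) 0 (by omega), Int.natAbs_neg, Int.natAbs_natCast, pow_mul]
    simp [h4, h8, hk, eps, h4']
  · have h4 : k % 4 = 3 := by omega
    have h4' : (k : ℤ) % 4 = 3 := by omega
    rw [key (-(2 * (k / 8 : ℕ) : ℕ)) 1 (by omega), Int.natAbs_neg, Int.natAbs_natCast, pow_mul]
    simp [h4, h8, hk, eps, h4']
  · have h4 : k % 4 = 1 := by omega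
    have h4' : (k : ℤ) % 4 = 1 := by omega
    rw [key (-(2 * (k / 8 : ℕ) + 1 : ℕ)) 0 (by omega), Int.natAbs_neg, Int.natAbs_natCast, pow_succ, pow_mul]
    simp [h4, h8, hk, eps, h4']
  · have h4 : k % 4 = 3 := by omega
    have h4' : (k : ℤ) % 4 = 3 := by omega
    rw [key (-(2 * (k / 8 : ℕ) + 1 : ℕ)) 1 (by omega), Int.natAbs_neg, Int.natAbs_natCast, pow_succ, pow_mul]
    simp [h4, h8, hk, eps, h4']

lemma gG_two (h : ℤ) (k : ℕ) (hk : k % 4 = 2) (hco : Int.gcd h k = 1) : gG h k = 0 := by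
  obtain ⟨d, rfl⟩ : ∃ d, k = d + d := ⟨k / 2, by omega⟩
  have hd : d % 2 = 1 := by omega
  have hd0 : (d : ℂ) ≠ 0 := by
    have : d ≠ 0 := by omega
    exact_mod_cast this
  have hh : h % 2 = 1 := by
    by_contra h2
    have : (2 : ℤ) ∣ (Int.gcd h (d + d : ℕ) : ℤ) := Int.dvd_coe_gcd (by omega) (by omega)
    rw [hco] at this; omega
  rw [gG, Finset.sum_range_add, ← Finset.sum_add_distrib]
  refine Finset.sum_eq_zero fun b _ => ?_
  have e : (2 * Real.pi * Complex.I * (-(h * ((d + b : ℕ) : ℂ) ^ 2)) / (d + d : ℕ)) =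
     (2 * Real.pi * Complex.I * (-(h * (b : ℂ) ^ 2)) / (d + d : ℕ)) + Real.pi * Complex.I * (-(h * (d + 2 * b)) : ℤ) := by
    push_cast
    have : (d : ℂ) + d ≠ 0 := by rw [← two_mul]; simpa using hd0
    field_simp; ring
  rw [e, exp_shift]
  have : Odd ((-(h * (d + 2 * b)) : ℤ).natAbs) := by
    rw [Int.natAbs_odd, Int.odd_iff]
    have : Odd (h * (d + 2 * b)) := (Int.odd_iff.2 hh).mul (by rw [Int.odd_iff]; omega)
    rw [Int.odd_iff] at this; omega
  rw [this.neg_one_pow]; ring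

lemma gG_four (h : ℤ) (k : ℕ) (hk0 : 0 < k) (hk : k % 4 = 0) (hco : Int.gcd h k = 1) :
    gG h k = (Real.sqrt 2 : ℂ) * (Real.sqrt k : ℂ) * Complex.exp (-(Real.pi * Complex.I) / 4) * eps h *
      (jacobiSym (k : ℤ) h.natAbs : ℂ) := by
  obtain ⟨d, rfl⟩ : ∃ d, k = d + d := ⟨k / 2, by omega⟩
  have hd : d % 2 = 0 := by omega
  have hdp : 0 < d := by omega
  have hd0 : (d : ℂ) ≠ 0 := by
    have : d ≠ 0 := by omega
    exact_mod_cast this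
  have hdd : (d : ℂ) + d ≠ 0 := by rw [← two_mul]; simpa using hd0
  have hh : h % 2 = 1 := by
    by_contra h2
    have : (2 : ℤ) ∣ (Int.gcd h (d + d : ℕ) : ℤ) := Int.dvd_coe_gcd (by omega) (by omega)
    rw [hco] at this; omega
  have e0 : gG h (d + d) = 2 * gS (-h) d := by
    rw [gG, Finset.sum_range_add, two_mul (gS (-h) d)]
    congr 1
    · refine Finset.sum_congr rfl fun b _ => ?_
      congr 1; push_cast; field_simp
      try ring
    · refine Finset.sum_congr rfl fun b _ => ?_
      have e : (2 * Real.pi * Complex.I * (-(h * ((d + b : ℕ) : ℂ) ^ 2)) / (d + d : ℕ)) =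
         (Real.pi * Complex.I * (-h : ℤ) * (b : ℂ) ^ 2 / d) + Real.pi * Complex.I * (-(h * (d + 2 * b)) : ℤ) := by
        push_cast
        field_simp; ring
      rw [e, exp_shift]
      have : Even ((-(h * (d + 2 * b)) : ℤ).natAbs) := by
        rw [Int.natAbs_even, even_neg]
        exact Even.mul_left (by rw [Int.even_iff]; omega) _
      rw [this.neg_one_pow]; ring
  have hc2 : Int.gcd (-h) d = 1 := by
    rw [← Int.isCoprime_iff_gcd_eq_one] at *
    rw [IsCoprime.neg_left_iff]
    push_cast at hco
    rw [← two_mul] at hco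
    exact hco.of_mul_right_right
  have hho : Odd h.natAbs := by rw [Nat.odd_iff]; omega
  rw [e0, gS_eq_gR _ _ _ rfl (by omega) ((by rw [Int.even_iff]; omega : Even (d : ℤ)).mul_left _) hc2, gR, if_neg (by omega),
    Int.natAbs_neg]
  have hs : (2 : ℂ) * (Real.sqrt d : ℂ) = (Real.sqrt 2 : ℂ) * (Real.sqrt (d + d : ℕ) : ℂ) := by
    push_cast
    rw [← two_mul, Real.sqrt_mul (by norm_num)]
    push_cast
    rw [← mul_assoc, ← Complex.ofReal_mul, Real.mul_self_sqrt (by norm_num)]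
    norm_num
  have hJ : jacobiSym ((d + d : ℕ) : ℤ) h.natAbs = jacobiSym 2 h.natAbs * jacobiSym d h.natAbs := by
    push_cast
    rw [← two_mul, jacobiSym.mul_left]
  rw [hJ, ← mul_assoc, ← mul_assoc, hs]
  have hJ2 : (jacobiSym 2 h.natAbs : ℂ) * (jacobiSym 2 h.natAbs : ℂ) = 1 := by
    rw [jacobiSym.at_two hho, ZMod.χ₈_nat_eq_if_mod_eight]
    split_ifs <;> first | (exfalso; omega) | norm_num
  have hmain : Complex.exp (Real.pi * Complex.I * (-h : ℤ) / 4) =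
      Complex.exp (-(Real.pi * Complex.I) / 4) * eps h * (jacobiSym 2 h.natAbs : ℂ) := by
    rw [jacobiSym.at_two hho, ZMod.χ₈_nat_eq_if_mod_eight]
    have key : ∀ n j : ℤ, (1 - h : ℤ) = 4 * n + 2 * j → Complex.exp (Real.pi * Complex.I * (-h : ℤ) / 4) =
      Complex.exp (-(Real.pi * Complex.I) / 4) * ((-1) ^ n.natAbs * Complex.exp (Real.pi / 2 * Complex.I) ^ j) := by
      intro n j hn
      rw [← exp_pi_int, ← Complex.exp_int_mul, ← Complex.exp_add, ← Complex.exp_add]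
      congr 1
      have : (h : ℂ) = 1 - 4 * n - 2 * j := by
        have : h = 1 - 4 * n - 2 * j := by omega
        exact_mod_cast congrArg (Int.cast : ℤ → ℂ) this
      push_cast
      rw [this]; ring
    rw [Complex.exp_pi_div_two_mul_I] at key
    have h8 : h % 8 = 1 ∨ h % 8 = 3 ∨ h % 8 = 5 ∨ h % 8 = 7 := by omega
    rw [mul_assoc (Complex.exp (-(Real.pi * Complex.I) / 4))]
    rcases h8 with h8 | h8 | h8 | h8
    · rw [key (-(2 * (h / 8))) 0 (by omega), (by rw [Int.natAbs_even, Int.even_iff]; omega : Even (Int.natAbs (-(2 * (h / 8))))).neg_one_pow]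
      rw [if_neg (by omega), if_pos (by omega), eps, if_pos (by omega)]; simp
    · rw [key (-(2 * (h / 8)) - 1) 1 (by omega), (by rw [Int.natAbs_odd, Int.odd_iff]; omega : Odd (Int.natAbs (-(2 * (h / 8)) - 1))).neg_one_pow]
      rw [if_neg (by omega), if_neg (by omega), eps, if_neg (by omega)]; simp
    · rw [key (-(2 * (h / 8)) - 1) 0 (by omega), (by rw [Int.natAbs_odd, Int.odd_iff]; omega : Odd (Int.natAbs (-(2 * (h / 8)) - 1))).neg_one_pow]
      rw [if_neg (by omega), if_neg (by omega), eps, if_pos (by omega)]; simp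
    · rw [key (-(2 * (h / 8)) - 2) 1 (by omega), (by rw [Int.natAbs_even, Int.even_iff]; omega : Even (Int.natAbs (-(2 * (h / 8)) - 2))).neg_one_pow]
      rw [if_neg (by omega), if_pos (by omega), eps, if_neg (by omega)]; simp
  rw [hmain]
  push_cast
  ring

end

section
open Filter Topology

abbrev SLZ := Matrix.SpecialLinearGroup (Fin 2) ℤ

lemma slz_det (γ : SLZ) : γ.1 0 0 * γ.1 1 1 - γ.1 0 1 * γ.1 1 0 = 1 := by
  have := γ.2
  rwa [Matrix.det_fin_two] at this

lemma formEval_act (γ : SLZ) (Q : ℤ × ℤ × ℤ) (x y : ℤ) : formEval (formAct γ Q) x y =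
    formEval Q (γ.1 0 0 * x + γ.1 0 1 * y) (γ.1 1 0 * x + γ.1 1 1 * y) := by
  simp only [formEval, formAct]; ring

lemma formAct_mul (γ δ : SLZ) (Q : ℤ × ℤ × ℤ) : formAct γ (formAct δ Q) = formAct (δ * γ) Q := by
  have h00 : (δ * γ).1 0 0 = δ.1 0 0 * γ.1 0 0 + δ.1 0 1 * γ.1 1 0 := by
    simp [Matrix.mul_apply, Fin.sum_univ_two]
  have h01 : (δ * γ).1 0 1 = δ.1 0 0 * γ.1 0 1 + δ.1 0 1 * γ.1 1 1 := by
    simp [Matrix.mul_apply, Fin.sum_univ_two]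
  have h10 : (δ * γ).1 1 0 = δ.1 1 0 * γ.1 0 0 + δ.1 1 1 * γ.1 1 0 := by
    simp [Matrix.mul_apply, Fin.sum_univ_two]
  have h11 : (δ * γ).1 1 1 = δ.1 1 0 * γ.1 0 1 + δ.1 1 1 * γ.1 1 1 := by
    simp [Matrix.mul_apply, Fin.sum_univ_two]
  simp only [formAct, h00, h01, h10, h11, Prod.mk.injEq, formEval]
  refine ⟨?_, ?_, ?_⟩ <;> ring

lemma formAct_one (Q : ℤ × ℤ × ℤ) : formAct 1 Q = Q := by
  obtain ⟨a, b, c⟩ := Q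
  simp [formAct, formEval]
  ring

lemma formAct_neg_one (Q : ℤ × ℤ × ℤ) : formAct (-1) Q = Q := by
  obtain ⟨a, b, c⟩ := Q
  simp [formAct, formEval]
  ring

lemma formDisc_act (γ : SLZ) (Q : ℤ × ℤ × ℤ) : formDisc (formAct γ Q) = formDisc Q := by
  have h : formDisc (formAct γ Q) = (γ.1 0 0 * γ.1 1 1 - γ.1 0 1 * γ.1 1 0) ^ 2 * formDisc Q := by
    simp only [formDisc, formAct, formEval]; ring
  rw [h, slz_det]; ring

lemma formEval_pos (Q : ℤ × ℤ × ℤ) (hQ : IsPosDef Q) (x y : ℤ) (h : x ≠ 0 ∨ y ≠ 0) :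
    0 < formEval Q x y := by
  obtain ⟨a, b, c⟩ := Q
  obtain ⟨ha, hd⟩ := hQ
  simp only [formDisc, formEval] at *
  by_cases hy : y = 0
  · subst hy
    have hx : x ≠ 0 := by tauto
    have : 0 < x ^ 2 := by positivity
    nlinarith
  · have hy2 : 0 < y ^ 2 := by positivity
    have : 0 < 4 * a * (a * x ^ 2 + b * x * y + c * y ^ 2) := by
      nlinarith [sq_nonneg (2 * a * x + b * y)]
    by_contra hcon
    push Not at hcon
    nlinarith

lemma posDef_act (γ : SLZ) (Q : ℤ × ℤ × ℤ) (hQ : IsPosDef Q) : IsPosDef (formAct γ Q) := by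
  refine ⟨?_, ?_⟩
  · refine formEval_pos Q hQ _ _ ?_
    by_contra h
    push Not at h
    have := slz_det γ
    rw [h.1, h.2] at this
    simp at this
  · rw [formDisc_act]; exact hQ.2

def WeakRed (Q : ℤ × ℤ × ℤ) : Prop := 0 < Q.1 ∧ |Q.2.1| ≤ Q.1 ∧ Q.1 ≤ Q.2.2
def StrictRed (Q : ℤ × ℤ × ℤ) : Prop := |Q.2.1| < Q.1 ∧ Q.1 < Q.2.2

lemma StrictRed.weak {Q : ℤ × ℤ × ℤ} (h : StrictRed Q) : WeakRed Q := by
  obtain ⟨h1, h2⟩ := h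
  exact ⟨lt_of_le_of_lt (abs_nonneg _) h1, h1.le, h2.le⟩

lemma WeakRed.posDef {Q : ℤ × ℤ × ℤ} (h : WeakRed Q) : IsPosDef Q := by
  obtain ⟨a, b, c⟩ := Q
  obtain ⟨h1, h2, h3⟩ := h
  refine ⟨h1, ?_⟩
  simp only [formDisc] at *
  have := sq_le_sq' (by rw [abs_le] at h2; exact h2.1) (abs_le.1 h2).2
  nlinarith

lemma exists_weakRed (Q : ℤ × ℤ × ℤ) (hQ : IsPosDef Q) : ∃ γ, WeakRed (formAct γ Q) := by
  classical
  have hex : ∃ n : ℕ, ∃ γ : SLZ, (formAct γ Q).1 = n := by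
    refine ⟨(formAct 1 Q).1.toNat, 1, ?_⟩
    have := (posDef_act 1 Q hQ).1
    omega
  obtain ⟨γ, hγ⟩ := Nat.find_spec hex
  have hmin : ∀ δ : SLZ, (formAct γ Q).1 ≤ (formAct δ Q).1 := by
    intro δ
    have h0 := (posDef_act δ Q hQ).1
    have := Nat.find_min' hex (m := (formAct δ Q).1.toNat) ⟨δ, by omega⟩
    rw [hγ]; omega
  set Q1 := formAct γ Q with hQ1
  have hp := posDef_act γ Q hQ
  rw [← hQ1] at hp
  let m : ℤ := -((Q1.2.1 + Q1.1) / (2 * Q1.1))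
  let T : SLZ := ⟨!![1, m; 0, 1], by simp [Matrix.det_fin_two]⟩
  let S : SLZ := ⟨!![0, -1; 1, 0], by simp [Matrix.det_fin_two]⟩
  refine ⟨γ * T, ?_⟩
  have hS := hmin (γ * T * S)
  rw [← formAct_mul, ← formAct_mul, ← hQ1] at hS
  rw [← formAct_mul, ← hQ1]
  have hT1 : (formAct T Q1).1 = Q1.1 := by simp [formAct, formEval, T]
  have hT2 : (formAct T Q1).2.1 = Q1.2.1 + 2 * Q1.1 * m := by simp [formAct, formEval, T]; ring
  have hS1 : (formAct S (formAct T Q1)).1 = (formAct T Q1).2.2 := by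
    generalize formAct T Q1 = Q2
    simp [formAct, formEval, S]
  rw [hS1] at hS
  refine ⟨by rw [hT1]; exact hp.1, ?_, by rw [hT1]; exact hS⟩
  rw [hT1, hT2]
  have h0 := hp.1
  have e1 := Int.emod_nonneg (Q1.2.1 + Q1.1) (show 2 * Q1.1 ≠ 0 by omega)
  have e2 := Int.emod_lt_of_pos (Q1.2.1 + Q1.1) (show 0 < 2 * Q1.1 by omega)
  have e3 := Int.mul_ediv_add_emod (Q1.2.1 + Q1.1) (2 * Q1.1)
  rw [abs_le]
  simp only [m]
  constructor <;> nlinarith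

lemma weak_min {Q : ℤ × ℤ × ℤ} (h : WeakRed Q) (x y : ℤ) (hxy : x ≠ 0 ∨ y ≠ 0) :
    Q.1 ≤ formEval Q x y := by
  obtain ⟨a, b, c⟩ := Q
  obtain ⟨h1, h2, h3⟩ := h
  simp only [formEval] at *
  have hb : -(a * |x * y|) ≤ b * x * y := by
    have : |b * x * y| ≤ a * |x * y| := by
      rw [mul_assoc, abs_mul]; exact mul_le_mul_of_nonneg_right h2 (abs_nonneg _)
    exact (abs_le.1 this).1
  have h4 : 2 * |x * y| ≤ x ^ 2 + y ^ 2 := by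
    rw [abs_mul]
    nlinarith [sq_nonneg (|x| - |y|), sq_abs x, sq_abs y]
  have h5 : 1 ≤ x ^ 2 + y ^ 2 - |x * y| := by
    by_contra hcon
    push Not at hcon
    have h6 : x ^ 2 + y ^ 2 ≤ 0 := by nlinarith [abs_nonneg (x * y)]
    have hx : x = 0 := by nlinarith [sq_nonneg x, sq_nonneg y]
    have hy : y = 0 := by nlinarith [sq_nonneg x, sq_nonneg y]
    tauto
  nlinarith [sq_nonneg y]

lemma strict_min {Q : ℤ × ℤ × ℤ} (h : StrictRed Q) (x y : ℤ) (hy : y ≠ 0) :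
    Q.1 < formEval Q x y := by
  obtain ⟨a, b, c⟩ := Q
  obtain ⟨h1, h2⟩ := h
  have h0 : 0 < a := lt_of_le_of_lt (abs_nonneg _) h1
  have hw := weak_min (Q := (a, b, a)) ⟨h0, h1.le, le_rfl⟩ x y (Or.inr hy)
  simp only [formEval] at *
  have : 0 < y ^ 2 := by positivity
  nlinarith

lemma strict_unique {Q : ℤ × ℤ × ℤ} (h : StrictRed Q) (γ : SLZ) (hw : WeakRed (formAct γ Q)) :
    γ = 1 ∨ γ = -1 := by
  have hdet := slz_det γ
  have ha : (formAct γ Q).1 ≤ Q.1 := by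
    have h1 := weak_min hw (γ.1 1 1) (-γ.1 1 0) (by
      by_contra hc
      push Not at hc
      have : γ.1 1 0 = 0 := by omega
      rw [hc.1, this] at hdet; simp at hdet)
    rw [formEval_act] at h1
    have e1 : γ.1 0 0 * γ.1 1 1 + γ.1 0 1 * -γ.1 1 0 = 1 := by linarith
    have e2 : γ.1 1 0 * γ.1 1 1 + γ.1 1 1 * -γ.1 1 0 = 0 := by ring
    rw [e1, e2] at h1
    have : formEval Q 1 0 = Q.1 := by simp [formEval]
    rwa [this] at h1
  have hr : γ.1 1 0 = 0 := by
    by_contra hr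
    have := strict_min h (γ.1 0 0) (γ.1 1 0) hr
    have h2 : (formAct γ Q).1 = formEval Q (γ.1 0 0) (γ.1 1 0) := rfl
    omega
  rw [hr] at hdet
  have hps : γ.1 0 0 * γ.1 1 1 = 1 := by linarith
  have h2 : (formAct γ Q).2.1 = Q.2.1 + 2 * Q.1 * (γ.1 0 0 * γ.1 0 1) := by
    have e : (formAct γ Q).2.1 = Q.2.1 * (γ.1 0 0 * γ.1 1 1) + 2 * Q.1 * (γ.1 0 0 * γ.1 0 1) := by
      simp only [formAct, formEval, hr]; ring
    rw [e, hps]; ring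
  have hq : γ.1 0 1 = 0 := by
    have hb' := hw.2.1
    rw [h2] at hb'
    have hb'' := le_trans hb' ha
    have hb := h.1
    rw [abs_le] at hb''
    rw [abs_lt] at hb
    have h3 : γ.1 0 0 * γ.1 0 1 < 1 := by by_contra hc; push Not at hc; nlinarith
    have h4 : -1 < γ.1 0 0 * γ.1 0 1 := by by_contra hc; push Not at hc; nlinarith
    have h5 : γ.1 0 0 * γ.1 0 1 = 0 := by omega
    rcases mul_eq_zero.1 h5 with h6 | h6
    · rw [h6] at hps; simp at hps
    · exact h6
  rcases Int.mul_eq_one_iff_eq_one_or_neg_one.1 hps with ⟨h6, h7⟩ | ⟨h6, h7⟩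
  · left
    ext i j
    fin_cases i <;> fin_cases j <;> simp [h6, h7, hr, hq]
  · right
    ext i j
    fin_cases i <;> fin_cases j <;> simp [h6, h7, hr, hq]

end

section
open Filter Topology

def strictSet (n : ℤ) : Set (ℤ × ℤ × ℤ) := {Q | StrictRed Q ∧ formDisc Q = -n}
def bdSet (n : ℤ) : Set (ℤ × ℤ × ℤ) := {Q | (WeakRed Q ∧ ¬ StrictRed Q) ∧ formDisc Q = -n}

lemma weak_finite (n : ℤ) : {Q : ℤ × ℤ × ℤ | WeakRed Q ∧ formDisc Q = -n}.Finite := by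
  refine (Set.finite_Icc ((1, -n, 1) : ℤ × ℤ × ℤ) (n, n, n)).subset ?_
  rintro ⟨a, b, c⟩ ⟨⟨h1, h2, h3⟩, h4⟩
  simp only [formDisc] at *
  have hb := sq_le_sq' (by rw [abs_le] at h2; exact h2.1) (abs_le.1 h2).2
  rw [abs_le] at h2
  have h5 : a ≤ n := by nlinarith
  have h6 : c ≤ n := by nlinarith
  simp only [Set.mem_Icc, Prod.mk_le_mk]
  omega

lemma card_stab (Q : ℤ × ℤ × ℤ) (h : StrictRed Q) (γ : SLZ) :
    Nat.card {δ : SLZ // formAct δ (formAct γ Q) = formAct γ Q} = 2 := by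
  have : {δ : SLZ | formAct δ (formAct γ Q) = formAct γ Q} = {1, -1} := by
    ext δ
    simp only [Set.mem_setOf_eq, Set.mem_insert_iff, Set.mem_singleton_iff]
    constructor
    · intro hd
      have h1 : formAct (γ * δ * γ⁻¹) Q = Q := by
        rw [← formAct_mul, ← formAct_mul, hd, formAct_mul, mul_inv_cancel, formAct_one]
      have h2 := strict_unique h (γ * δ * γ⁻¹) (by rw [h1]; exact h.weak)
      rcases h2 with h2 | h2
      · left
        rw [mul_inv_eq_one] at h2
        simpa using h2
      · right
        rw [mul_inv_eq_iff_eq_mul] at h2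
        have : γ * δ = γ * (-1) := by rw [h2]; simp
        exact mul_left_cancel this
    · rintro (rfl | rfl)
      · rw [formAct_one]
      · rw [formAct_neg_one]
  have h2 : Nat.card ({δ : SLZ | formAct δ (formAct γ Q) = formAct γ Q} : Set SLZ) = 2 := by
    rw [Nat.card_coe_set_eq, this, Set.ncard_pair]
    intro hc
    have := congrArg (fun M : SLZ => M.1 0 0) hc
    simp at this
  exact h2

lemma class_bound (n : ℤ) (hn : 0 < n) :
    |hurwitzClassNumber n - (strictSet n).ncard| ≤ 2 * (bdSet n).ncard := by
  classical
  let X := {Q : ℤ × ℤ × ℤ // formDisc Q = -n ∧ IsPosDef Q}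
  let R : X → X → Prop := fun Q Q' => ∃ γ : SLZ, formAct γ Q.1 = Q'.1
  have hR : Equivalence R := by
    refine ⟨fun Q => ⟨1, formAct_one _⟩, ?_, ?_⟩
    · rintro Q Q' ⟨γ, h⟩
      exact ⟨γ⁻¹, by rw [← h, formAct_mul, mul_inv_cancel, formAct_one]⟩
    · rintro Q Q' Q'' ⟨γ, h⟩ ⟨δ, h'⟩
      exact ⟨γ * δ, by rw [← formAct_mul, h, h']⟩
  have hq : ∀ Q Q' : X, Quot.mk R Q = Quot.mk R Q' → R Q Q' := fun Q Q' h =>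
    hR.eqvGen_iff.1 (Quot.eqvGen_exact h)
  let W := {Q : ℤ × ℤ × ℤ // WeakRed Q ∧ formDisc Q = -n}
  have hWf : Finite W := (weak_finite n).to_subtype
  let f : W → FormClasses n := fun Q => Quot.mk R ⟨Q.1, Q.2.2, Q.2.1.posDef⟩
  have hfs : Function.Surjective f := by
    intro c
    obtain ⟨Q, rfl⟩ := Quot.exists_rep c
    obtain ⟨γ, hγ⟩ := exists_weakRed Q.1 Q.2.2
    refine ⟨⟨formAct γ Q.1, hγ, by rw [formDisc_act]; exact Q.2.1⟩, ?_⟩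
    exact (Quot.sound ⟨γ, rfl⟩).symm
  have hfin : Finite (FormClasses n) := Finite.of_surjective f hfs
  have hfu : ∀ Q Q' : W, StrictRed Q.1 → f Q = f Q' → Q = Q' := by
    intro Q Q' hQ hQQ
    obtain ⟨γ, hγ⟩ := hq _ _ hQQ
    simp only at hγ
    have := strict_unique hQ γ (by rw [hγ]; exact Q'.2.1)
    apply Subtype.ext
    rw [← hγ]
    rcases this with rfl | rfl
    · rw [formAct_one]
    · rw [formAct_neg_one]
  let w : FormClasses n → ℝ := fun c => (2 : ℝ) / (Nat.card {γ : SLZ // formAct γ c.out.1 = c.out.1})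
  have hw0 : ∀ c, 0 ≤ w c := fun c => by positivity
  have hw2 : ∀ c, w c ≤ 2 := by
    intro c
    simp only [w]
    rcases Nat.eq_zero_or_pos (Nat.card {γ : SLZ // formAct γ c.out.1 = c.out.1}) with h | h
    · rw [h]; simp
    · apply div_le_self (by norm_num)
      exact_mod_cast h
  have hw1 : ∀ Q : W, StrictRed Q.1 → w (f Q) = 1 := by
    intro Q hQ
    have h1 : Quot.mk R ⟨Q.1, Q.2.2, Q.2.1.posDef⟩ = Quot.mk R (Quot.out (f Q)) := (Quot.out_eq _).symm
    obtain ⟨γ, hγ⟩ := hq _ _ h1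
    simp only at hγ
    simp only [w]
    rw [← hγ, card_stab _ hQ]; norm_num
  have := Fintype.ofFinite (FormClasses n)
  have := Fintype.ofFinite W
  have hH : hurwitzClassNumber n = ∑ c : FormClasses n, w c := by
    rw [hurwitzClassNumber, if_neg hn.ne', finsum_eq_sum_of_fintype]
  let A : Finset W := Finset.univ.filter (fun Q => StrictRed Q.1)
  let B : Finset W := Finset.univ.filter (fun Q => ¬ StrictRed Q.1)
  have hA : (strictSet n).ncard = A.card := by
    rw [← Set.ncard_coe_finset, ← Set.ncard_image_of_injective _ Subtype.val_injective]
    congr 1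
    ext Q
    simp only [A, strictSet, Set.mem_setOf_eq, Finset.coe_filter, Finset.mem_univ, true_and, Set.mem_image]
    constructor
    · rintro ⟨h1, h2⟩
      exact ⟨⟨Q, h1.weak, h2⟩, h1, rfl⟩
    · rintro ⟨Q', h1, rfl⟩
      exact ⟨h1, Q'.2.2⟩
  have hB : (bdSet n).ncard = B.card := by
    rw [← Set.ncard_coe_finset, ← Set.ncard_image_of_injective _ Subtype.val_injective]
    congr 1
    ext Q
    simp only [B, bdSet, Set.mem_setOf_eq, Finset.coe_filter, Finset.mem_univ, true_and, Set.mem_image]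
    constructor
    · rintro ⟨h1, h2⟩
      exact ⟨⟨Q, h1.1, h2⟩, h1.2, rfl⟩
    · rintro ⟨Q', h1, rfl⟩
      exact ⟨⟨Q'.2.1, h1⟩, Q'.2.2⟩
  have h1 : ∑ c ∈ A.image f, w c = A.card := by
    rw [Finset.sum_image]
    · rw [Finset.sum_congr rfl (fun Q hQ => hw1 Q (by simpa [A] using hQ))]
      simp
    · intro Q hQ Q' _ h
      exact hfu Q Q' (by simpa [A] using hQ) h
  have h2 : ∑ c ∈ (A.image f)ᶜ, w c ≤ 2 * B.card := by
    calc ∑ c ∈ (A.image f)ᶜ, w c ≤ ∑ c ∈ (A.image f)ᶜ, 2 := Finset.sum_le_sum fun c _ => hw2 c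
      _ = 2 * ((A.image f)ᶜ).card := by simp [mul_comm]
      _ ≤ 2 * B.card := by
        have : ((A.image f)ᶜ).card ≤ B.card := by
          refine le_trans (Finset.card_le_card ?_) (Finset.card_image_le (s := B) (f := f))
          intro c hc
          obtain ⟨Q, rfl⟩ := hfs c
          refine Finset.mem_image_of_mem _ ?_
          simp only [B, Finset.mem_filter, Finset.mem_univ, true_and]
          intro hQ
          rw [Finset.mem_compl] at hc
          exact hc (Finset.mem_image_of_mem _ (by simpa [A] using hQ))
        have : (((A.image f)ᶜ).card : ℝ) ≤ B.card := by exact_mod_cast this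
        linarith
  have h3 : 0 ≤ ∑ c ∈ (A.image f)ᶜ, w c := Finset.sum_nonneg fun c _ => hw0 c
  rw [hH, hA, hB, ← Finset.sum_add_sum_compl (A.image f), h1, add_sub_cancel_left, abs_of_nonneg h3]
  exact h2

end

section
open Filter Topology

def qD (Q : ℤ × ℤ × ℤ) : ℕ := (-formDisc Q).toNat

lemma qD_ge {Q : ℤ × ℤ × ℤ} (h : WeakRed Q) : 3 * (Q.1 * Q.2.2) ≤ qD Q ∧ (qD Q : ℤ) = -formDisc Q := by
  have hp := h.posDef.2
  have e : (qD Q : ℤ) = -formDisc Q := by simp only [qD]; omega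
  refine ⟨?_, e⟩
  rw [e]
  obtain ⟨a, b, c⟩ := Q
  obtain ⟨h1, h2, h3⟩ := h
  simp only [formDisc] at *
  have hb := sq_le_sq' (by rw [abs_le] at h2; exact h2.1) (abs_le.1 h2).2
  nlinarith

lemma fiber_sum {ι : Type*} (D : ι → ℕ) (hfin : ∀ n, (D ⁻¹' {n}).Finite) (q : ℂ)
    (hs : Summable (fun x => ‖q‖ ^ D x)) :
    HasSum (fun n : ℕ => ((D ⁻¹' {n}).ncard : ℂ) * q ^ n) (∑' x, q ^ D x) := by
  have hs' : Summable (fun x => q ^ D x) := by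
    apply Summable.of_norm; simpa using hs
  have h1 : HasSum (fun p : Σ n, {x // D x = n} => q ^ D p.2.1) (∑' x, q ^ D x) :=
    ((Equiv.sigmaFiberEquiv D).hasSum_iff (f := fun x => q ^ D x)).2 hs'.hasSum
  refine h1.sigma ?_
  intro n
  have : Fintype {x // D x = n} := (hfin n).fintype
  have h2 : ((D ⁻¹' {n}).ncard : ℂ) * q ^ n = ∑ x : {x // D x = n}, q ^ D x.1 := by
    rw [Finset.sum_congr rfl (fun x _ => by rw [x.2])]
    rw [Finset.sum_const, nsmul_eq_mul, Finset.card_univ, ← Nat.card_eq_fintype_card]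
    rfl
  rw [h2]
  exact hasSum_fintype _

abbrev Str := {Q : ℤ × ℤ × ℤ // StrictRed Q}
abbrev Bd := {Q : ℤ × ℤ × ℤ // WeakRed Q ∧ ¬ StrictRed Q}

lemma summable_weak (r : ℝ) (hr0 : 0 ≤ r) (hr1 : r < 1) (P : ℤ × ℤ × ℤ → Prop) (hP : ∀ Q, P Q → WeakRed Q) :
    Summable (fun Q : {Q // P Q} => r ^ qD Q.1) := by
  have h1 : Summable (fun n : ℤ => r ^ n.natAbs) := by
    rw [summable_int_iff_summable_nat_and_neg]
    simp only [Int.natAbs_neg, Int.natAbs_natCast]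
    exact ⟨summable_geometric_of_lt_one hr0 hr1, summable_geometric_of_lt_one hr0 hr1⟩
  have h2 : Summable (fun p : ℤ × ℤ × ℤ => r ^ p.1.natAbs * (r ^ p.2.1.natAbs * r ^ p.2.2.natAbs)) :=
    h1.mul_of_nonneg (h1.mul_of_nonneg h1 (fun _ => by simp only [Pi.zero_apply]; positivity)
      (fun _ => by simp only [Pi.zero_apply]; positivity)) (fun _ => by simp only [Pi.zero_apply]; positivity)
      (fun _ => by simp only [Pi.zero_apply]; positivity)
  refine Summable.of_nonneg_of_le (fun _ => by positivity) ?_ (h2.comp_injective Subtype.val_injective)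
  rintro ⟨⟨a, b, c⟩, hQ⟩
  have hw := hP _ hQ
  have hge := (qD_ge hw).1
  simp only [Function.comp]
  rw [← pow_add, ← pow_add]
  apply pow_le_pow_of_le_one hr0 hr1.le
  obtain ⟨h1, h2, h3⟩ := hw
  simp only at *
  rw [abs_le] at h2
  have h4 : a ≤ a * c := by nlinarith
  have h5 : c ≤ a * c := by nlinarith
  omega

lemma exp_bound (x : ℝ) (hx : 0 < x) : Real.exp (-x) ≤ 2 * x ^ (-(5 / 4) : ℝ) := by
  have h1 : x ^ ((5 : ℝ) / 4) ≤ 1 + x ^ 2 := by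
    rcases le_total x 1 with h | h
    · have := Real.rpow_le_one hx.le h (show (0 : ℝ) ≤ 5 / 4 by norm_num)
      nlinarith [sq_nonneg x]
    · have := Real.rpow_le_rpow_of_exponent_le h (show (5 : ℝ) / 4 ≤ 2 by norm_num)
      rw [Real.rpow_two] at this
      linarith
  have h2 : 1 + x + x ^ 2 / 2 ≤ Real.exp x := Real.quadratic_le_exp_of_nonneg hx.le
  rw [Real.rpow_neg hx.le, Real.exp_neg, ← div_eq_mul_inv]
  have hp : 0 < x ^ ((5 : ℝ) / 4) := Real.rpow_pos_of_pos hx _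
  rw [inv_eq_one_div, div_le_div_iff₀ (Real.exp_pos _) hp]
  linarith

noncomputable def fw (n : ℤ) : ℝ := (max (|n| : ℝ) 1) ^ (-(5 / 4) : ℝ)

lemma fw_summable : Summable fw := by
  have h0 : Summable (fun n : ℕ => (max (n : ℝ) 1) ^ (-(5 / 4) : ℝ)) := by
    have : Summable (fun n : ℕ => (n : ℝ) ^ (-(5 / 4) : ℝ)) := Real.summable_nat_rpow.2 (by norm_num)
    rw [← summable_nat_add_iff 1] at this ⊢
    refine this.congr ?_
    intro n
    rw [max_eq_left]
    push_cast
    have : (0 : ℝ) ≤ n := n.cast_nonneg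
    linarith
  rw [summable_int_iff_summable_nat_and_neg]
  simp only [fw]
  push_cast
  simp only [abs_neg, Nat.abs_cast]
  exact ⟨h0, h0⟩

lemma fw_nonneg (n : ℤ) : 0 ≤ fw n := by unfold fw; positivity

lemma fw_anti {m n : ℤ} (h : |m| ≤ |n|) : fw n ≤ fw m := by
  unfold fw
  apply Real.rpow_le_rpow_of_nonpos (by positivity) _ (by norm_num)
  apply max_le_max _ le_rfl
  exact_mod_cast h

lemma fw_pos {n : ℤ} (h : 0 < n) : fw n = (n : ℝ) ^ (-(5 / 4) : ℝ) := by
  unfold fw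
  have : (1 : ℝ) ≤ n := by exact_mod_cast h
  rw [abs_of_pos (by linarith), max_eq_left this]

lemma weak_exp_bound {Q : ℤ × ℤ × ℤ} (h : WeakRed Q) (t : ℝ) (ht : 0 < t) :
    Real.exp (-t) ^ qD Q ≤ 2 * t ^ (-(5 / 4) : ℝ) * (fw Q.1 * fw Q.2.2) := by
  obtain ⟨a, b, c⟩ := Q
  have hge := (qD_ge h).1
  obtain ⟨h1, h2, h3⟩ := h
  simp only at *
  have hc : 0 < c := by omega
  rw [fw_pos h1, fw_pos hc, ← Real.exp_nat_mul]
  have ha' : (0 : ℝ) < a := by exact_mod_cast h1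
  have hc' : (0 : ℝ) < c := by exact_mod_cast hc
  have hge' : (a : ℝ) * c ≤ qD (a, b, c) := by
    have : a * c ≤ qD (a, b, c) := by nlinarith
    exact_mod_cast this
  calc Real.exp (qD (a, b, c) * -t) ≤ Real.exp (-(t * (a * c))) := by
        apply Real.exp_le_exp.2; nlinarith
    _ ≤ 2 * (t * (a * c)) ^ (-(5 / 4) : ℝ) := exp_bound _ (by positivity)
    _ = _ := by
      rw [Real.mul_rpow ht.le (by positivity), Real.mul_rpow ha'.le hc'.le]; ring

lemma bd_bound : ∃ C : ℝ, 0 ≤ C ∧ ∀ t : ℝ, 0 < t → ∑' Q : Bd, Real.exp (-t) ^ qD Q.1 ≤ C * t ^ (-(5 / 4) : ℝ) := by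
  classical
  let s : Bd → (ℤ × ℤ) × Fin 3 := fun Q => if Q.1.2.1 = Q.1.1 then ((Q.1.1, Q.1.2.2), 0) else
    if Q.1.2.1 = - Q.1.1 then ((Q.1.1, Q.1.2.2), 1) else ((Q.1.1, Q.1.2.1), 2)
  have hbd : ∀ Q : Bd, Q.1.2.1 = Q.1.1 ∨ Q.1.2.1 = - Q.1.1 ∨ Q.1.2.2 = Q.1.1 := by
    rintro ⟨⟨a, b, c⟩, ⟨h1, h2, h3⟩, h4⟩
    change 0 < a at h1
    change |b| ≤ a at h2
    change a ≤ c at h3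
    change b = a ∨ b = -a ∨ c = a
    rw [abs_le] at h2
    by_contra hc
    push Not at hc
    refine h4 ⟨?_, ?_⟩
    · simp only
      rw [abs_lt]
      omega
    · simp only
      omega
  have hs : Function.Injective s := by
    intro Q Q' h
    have hQ := hbd Q
    have hQ' := hbd Q'
    obtain ⟨⟨a, b, c⟩, h1⟩ := Q
    obtain ⟨⟨a', b', c'⟩, h1'⟩ := Q'
    simp only [s] at *
    apply Subtype.ext
    simp only [Prod.mk.injEq]
    split_ifs at h <;> simp at h <;> omega
  let G : (ℤ × ℤ) × Fin 3 → ℝ := fun p => fw p.1.1 * fw p.1.2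
  have hG : Summable G := by
    have h1 : Summable (fun p : ℤ × ℤ => fw p.1 * fw p.2) :=
      fw_summable.mul_of_nonneg fw_summable (fun n => fw_nonneg n) (fun n => fw_nonneg n)
    have h2 : Summable (fun _ : Fin 3 => (1 : ℝ)) := (hasSum_fintype _).summable
    have := h1.mul_of_nonneg h2 (fun p => mul_nonneg (fw_nonneg _) (fw_nonneg _)) (fun _ => by simp)
    simpa using this
  have hGs : Summable (fun Q => G (s Q)) := hG.comp_injective hs
  refine ⟨2 * ∑' Q, G (s Q), mul_nonneg (by norm_num) (tsum_nonneg fun Q => mul_nonneg (fw_nonneg _) (fw_nonneg _)), ?_⟩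
  intro t ht
  have hr1 : Real.exp (-t) < 1 := by rw [Real.exp_lt_one_iff]; linarith
  have hsum := summable_weak (Real.exp (-t)) (Real.exp_pos _).le hr1
    (fun Q => WeakRed Q ∧ ¬ StrictRed Q) (fun Q h => h.1)
  rw [mul_right_comm, ← tsum_mul_left]
  refine hsum.tsum_le_tsum ?_ (hGs.mul_left _)
  intro Q
  have h1 := weak_exp_bound Q.2.1 t ht
  refine h1.trans ?_
  refine mul_le_mul_of_nonneg_left ?_ (by positivity)
  simp only [G, s]
  split_ifs with h2 h3
  · exact le_rfl
  · exact le_rfl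
  · have h4 : Q.1.2.2 = Q.1.1 := by have := hbd Q; tauto
    simp only [h4]
    refine mul_le_mul_of_nonneg_left ?_ (fw_nonneg _)
    apply fw_anti
    have := Q.2.1.2.1
    rwa [abs_of_pos Q.2.1.1]

lemma ncard_fiber (P : ℤ × ℤ × ℤ → Prop) (hP : ∀ Q, P Q → WeakRed Q) (n : ℕ) :
    ((fun Q : {Q // P Q} => qD Q.1) ⁻¹' {n}).Finite ∧
    ((fun Q : {Q // P Q} => qD Q.1) ⁻¹' {n}).ncard = {Q : ℤ × ℤ × ℤ | P Q ∧ formDisc Q = -n}.ncard := by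
  have e : Subtype.val '' ((fun Q : {Q // P Q} => qD Q.1) ⁻¹' {n}) = {Q : ℤ × ℤ × ℤ | P Q ∧ formDisc Q = -n} := by
    ext Q
    simp only [Set.mem_image, Set.mem_preimage, Set.mem_singleton_iff, Set.mem_ofPred_eq]
    constructor
    · rintro ⟨Q', h1, rfl⟩
      refine ⟨Q'.2, ?_⟩
      have := (qD_ge (hP _ Q'.2)).2
      omega
    · rintro ⟨h1, h2⟩
      refine ⟨⟨Q, h1⟩, ?_, rfl⟩
      have := (qD_ge (hP _ h1)).2
      simp only
      omega
  constructor
  · refine Set.Finite.of_finite_image ?_ Subtype.val_injective.injOn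
    rw [e]
    refine (weak_finite n).subset ?_
    rintro Q ⟨h1, h2⟩
    exact ⟨hP _ h1, h2⟩
  · rw [← e, Set.ncard_image_of_injective _ Subtype.val_injective]

lemma genH : ∃ C : ℝ, 0 ≤ C ∧ ∀ (t : ℝ) (q : ℂ), 0 < t → ‖q‖ = Real.exp (-t) →
    ‖(∑' n : ℕ, (hurwitzClassNumber (n : ℤ) : ℂ) * q ^ n) - ∑' Q : Str, q ^ qD Q.1‖ ≤
      C * t ^ (-(5 / 4) : ℝ) + 1 := by
  obtain ⟨C, hC, hb⟩ := bd_bound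
  refine ⟨2 * C, by positivity, ?_⟩
  intro t q ht hq
  have hr1 : Real.exp (-t) < 1 := by rw [Real.exp_lt_one_iff]; linarith
  have hS := fiber_sum (fun Q : Str => qD Q.1) (fun n => (ncard_fiber _ (fun Q h => h.weak) n).1) q
    (by rw [hq]; exact summable_weak _ (Real.exp_pos _).le hr1 _ (fun Q h => h.weak))
  have hB0 := fiber_sum (fun Q : Bd => qD Q.1) (fun n => (ncard_fiber _ (fun Q h => h.1) n).1) ((Real.exp (-t) : ℝ) : ℂ)
    (by
      rw [Complex.norm_real, Real.norm_of_nonneg (Real.exp_pos _).le]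
      exact summable_weak _ (Real.exp_pos _).le hr1 _ (fun Q h => h.1))
  have hB : HasSum (fun n : ℕ => ((bdSet n).ncard : ℝ) * Real.exp (-t) ^ n) (∑' Q : Bd, Real.exp (-t) ^ qD Q.1) := by
    have h1 : (∑' Q : Bd, ((Real.exp (-t) : ℝ) : ℂ) ^ qD Q.1) = ((∑' Q : Bd, Real.exp (-t) ^ qD Q.1 : ℝ) : ℂ) := by
      rw [Complex.ofReal_tsum]; simp only [Complex.ofReal_pow]
    rw [h1] at hB0
    rw [← Complex.hasSum_ofReal]
    convert hB0 using 2 with n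
    rw [(ncard_fiber _ (fun Q h => h.1) n).2]
    push_cast
    rfl
  have hS2 : HasSum (fun n : ℕ => ((strictSet n).ncard : ℂ) * q ^ n) (∑' Q : Str, q ^ qD Q.1) := by
    convert hS using 3 with n
    rw [(ncard_fiber _ (fun Q h => h.weak) n).2]
    rfl
  have h1 : HasSum (fun n : ℕ => if n = 0 then (1 : ℝ) else 0) 1 := by
    convert hasSum_ite_eq (0 : ℕ) (1 : ℝ) using 1
  have hM := (hB.mul_left 2).add h1
  have hz : (strictSet 0).ncard = 0 := by
    have : strictSet 0 = ∅ := by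
      ext Q
      simp only [Set.mem_empty_iff_false, iff_false]
      rintro ⟨h1, h2⟩
      have := h1.weak.posDef.2
      omega
    rw [this]; simp
  have hterm : ∀ n : ℕ, ‖(hurwitzClassNumber (n : ℤ) : ℂ) * q ^ n - ((strictSet n).ncard : ℂ) * q ^ n‖ ≤
      2 * (((bdSet n).ncard : ℝ) * Real.exp (-t) ^ n) + if n = 0 then (1 : ℝ) else 0 := by
    intro n
    rw [← sub_mul, norm_mul, norm_pow, hq]
    by_cases hn : n = 0
    · subst hn
      have : ‖(hurwitzClassNumber ((0 : ℕ) : ℤ) : ℂ) - ((strictSet ((0 : ℕ) : ℤ)).ncard : ℂ)‖ ≤ 1 := by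
        rw [Nat.cast_zero, hz, hurwitzClassNumber, if_pos rfl]
        norm_num
      simp only [pow_zero, mul_one, if_true]
      have h0 : (0 : ℝ) ≤ (bdSet ((0 : ℕ) : ℤ)).ncard := by positivity
      linarith
    · rw [if_neg hn, add_zero, ← mul_assoc]
      refine mul_le_mul_of_nonneg_right ?_ (by positivity)
      have := class_bound n (by omega)
      have e : (hurwitzClassNumber (n : ℤ) : ℂ) - ((strictSet n).ncard : ℂ) =
        ((hurwitzClassNumber (n : ℤ) - (strictSet n).ncard : ℝ) : ℂ) := by push_cast; rfl
      rw [e, Complex.norm_real]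
      exact this
  have hds : Summable (fun n : ℕ => (hurwitzClassNumber (n : ℤ) : ℂ) * q ^ n - ((strictSet n).ncard : ℂ) * q ^ n) :=
    Summable.of_norm_bounded hM.summable hterm
  have hHs : Summable (fun n : ℕ => (hurwitzClassNumber (n : ℤ) : ℂ) * q ^ n) := by
    have := hds.add hS2.summable
    simpa using this
  rw [← hS2.tsum_eq, ← hHs.tsum_sub hS2.summable]
  refine (tsum_of_norm_bounded hM hterm).trans ?_
  have := hb t ht
  linarith

end

section
open Filter Topology

lemma gauss_sum (β : ℝ) (hβ : 0 < β) :
    Summable (fun n : ℕ => Real.exp (-(β * ((n : ℝ) + 1) ^ 2))) ∧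
    |(∑' n : ℕ, Real.exp (-(β * ((n : ℝ) + 1) ^ 2))) - Real.sqrt (Real.pi / β) / 2| ≤ 1 := by
  let f : ℝ → ℝ := fun x => Real.exp (-β * x ^ 2)
  have anti : AntitoneOn f (Set.Ici 0) := by
    intro x hx y hy hxy
    simp only [f]
    apply Real.exp_le_exp.2
    have : x ^ 2 ≤ y ^ 2 := pow_le_pow_left₀ hx hxy 2
    nlinarith
  have hint : MeasureTheory.IntegrableOn f (Set.Ioi 0) := (integrable_exp_neg_mul_sq hβ).integrableOn
  have hnn : ∀ t ∈ Set.Ioi (0 : ℝ), 0 ≤ f t := fun t _ => (Real.exp_pos _).le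
  have hs := anti.summable_of_integrableOn_Ioi_zero hint hnn
  have h1 := anti.tsum_add_one_le_integral hint hnn
  have h2 := anti.integral_le_tsum hs hnn
  rw [hs.tsum_eq_zero_add] at h2
  have h3 : ∫ x in Set.Ioi 0, f x = Real.sqrt (Real.pi / β) / 2 := integral_gaussian_Ioi β
  have h4 : ∀ n : ℕ, f ((n + 1 : ℕ) : ℝ) = Real.exp (-(β * ((n : ℝ) + 1) ^ 2)) := by
    intro n; simp only [f]; push_cast; ring_nf
  have h5 : f ((0 : ℕ) : ℝ) = 1 := by simp [f]
  simp only [h4, h5, h3] at h1 h2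
  refine ⟨?_, ?_⟩
  · have := (summable_nat_add_iff 1).2 hs
    simpa only [h4] using this
  · rw [abs_le]; constructor <;> linarith

noncomputable def mainf (a t : ℝ) : ℝ := ∫ s in (0 : ℝ)..1, Real.exp (-((4 - s ^ 2) * (a ^ 2 * t)))

lemma arcsin_int : ∫ s in (0 : ℝ)..1, 1 / Real.sqrt (4 - s ^ 2) = Real.pi / 6 := by
  have hd : ∀ s ∈ Set.uIcc (0 : ℝ) 1, HasDerivAt (fun s : ℝ => Real.arcsin (s / 2)) (1 / Real.sqrt (4 - s ^ 2)) s := by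
    intro s hs
    rw [Set.uIcc_of_le zero_le_one] at hs
    obtain ⟨h0, h1⟩ := hs
    have h := (Real.hasDerivAt_arcsin (x := s / 2) (by linarith) (by linarith)).comp s
      ((hasDerivAt_id s).div_const 2)
    have e : 1 / Real.sqrt (4 - s ^ 2) = 1 / Real.sqrt (1 - (s / 2) ^ 2) * (1 / 2) := by
      have : (4 - s ^ 2) = 2 ^ 2 * (1 - (s / 2) ^ 2) := by ring
      rw [this, Real.sqrt_mul (by norm_num), Real.sqrt_sq (by norm_num)]
      have : Real.sqrt (1 - (s / 2) ^ 2) ≠ 0 := (Real.sqrt_pos.2 (by nlinarith)).ne'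
      field_simp
    rw [e]
    exact h
  rw [intervalIntegral.integral_eq_sub_of_hasDerivAt hd]
  · have : Real.arcsin (1 / 2) = Real.pi / 6 := by
      rw [← Real.sin_pi_div_six, Real.arcsin_sin] <;> linarith [Real.pi_pos]
    simp only [this]; simp
  · apply ContinuousOn.intervalIntegrable
    apply ContinuousOn.div continuousOn_const (by fun_prop)
    intro s hs
    rw [Set.uIcc_of_le zero_le_one] at hs
    obtain ⟨h0, h1⟩ := hs
    exact (Real.sqrt_pos.2 (by nlinarith)).ne'

lemma mainf_nonneg (a t : ℝ) : 0 ≤ mainf a t :=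
  intervalIntegral.integral_nonneg zero_le_one (fun _ _ => (Real.exp_pos _).le)

lemma mainf_bound (k0 : ℕ) (hk0 : 0 < k0) (t : ℝ) (ht : 0 < t) :
    Summable (fun m : ℕ => mainf ((k0 * (m + 1) : ℕ) : ℝ) t) ∧
    |Real.sqrt t * (∑' m : ℕ, mainf ((k0 * (m + 1) : ℕ) : ℝ) t)
      - Real.sqrt Real.pi * Real.pi / (12 * k0)| ≤ Real.sqrt t := by
  have hk : (0 : ℝ) < k0 := by exact_mod_cast hk0
  let F : ℕ → ℝ → ℝ := fun m s => Real.exp (-((4 - s ^ 2) * (((k0 * (m + 1) : ℕ) : ℝ) ^ 2 * t)))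
  have hF : ∀ m s, F m s = Real.exp (-((4 - s ^ 2) * (k0 ^ 2 * t) * ((m : ℝ) + 1) ^ 2)) := by
    intro m s; simp only [F]; push_cast; ring_nf
  have hc : ∀ m, Continuous (F m) := by intro m; simp only [F]; fun_prop
  let u : ℕ → ℝ := fun m => Real.exp (-((3 * (k0 ^ 2 * t)) * ((m : ℝ) + 1) ^ 2))
  have hu : Summable u := (gauss_sum (3 * (k0 ^ 2 * t)) (by positivity)).1
  have hb : ∀ m, ∀ s ∈ Set.Icc (0 : ℝ) 1, ‖F m s‖ ≤ u m := by
    intro m s hs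
    rw [hF, Real.norm_of_nonneg (Real.exp_pos _).le]
    apply Real.exp_le_exp.2
    have h1 : 3 ≤ 4 - s ^ 2 := by nlinarith [hs.1, hs.2]
    have h2 : 0 ≤ (k0 ^ 2 * t) * ((m : ℝ) + 1) ^ 2 := by positivity
    nlinarith
  have hcont : ContinuousOn (fun s => ∑' m, F m s) (Set.Icc 0 1) :=
    continuousOn_tsum (fun m => (hc m).continuousOn) hu (fun m s hs => hb m s hs)
  have hsum : HasSum (fun m => ∫ s in (0 : ℝ)..1, F m s) (∫ s in (0 : ℝ)..1, ∑' m, F m s) := by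
    refine intervalIntegral.hasSum_integral_of_dominated_convergence (fun m _ => u m)
      (fun m => (hc m).aestronglyMeasurable) ?_ ?_ ?_ ?_
    · intro m
      refine Eventually.of_forall fun s hs => hb m s ?_
      rw [Set.uIoc_of_le zero_le_one] at hs
      exact ⟨hs.1.le, hs.2⟩
    · exact Eventually.of_forall fun s hs => hu
    · simp
    · refine Eventually.of_forall fun s hs => ?_
      rw [Set.uIoc_of_le zero_le_one] at hs
      exact (Summable.of_norm_bounded hu (fun m => hb m s ⟨hs.1.le, hs.2⟩)).hasSum
  refine ⟨hsum.summable, ?_⟩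
  have e1 : ∑' m : ℕ, mainf ((k0 * (m + 1) : ℕ) : ℝ) t = ∫ s in (0 : ℝ)..1, ∑' m, F m s := hsum.tsum_eq
  have e2 : Real.sqrt Real.pi * Real.pi / (12 * k0) =
      ∫ s in (0 : ℝ)..1, (Real.sqrt Real.pi / (2 * k0)) * (1 / Real.sqrt (4 - s ^ 2)) := by
    rw [intervalIntegral.integral_const_mul, arcsin_int]; field_simp; norm_num
  have hi1 : IntervalIntegrable (fun s => Real.sqrt t * ∑' m, F m s) MeasureTheory.volume 0 1 := by
    apply ContinuousOn.intervalIntegrable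
    rw [Set.uIcc_of_le zero_le_one]
    exact continuousOn_const.mul hcont
  have hi2 : IntervalIntegrable (fun s : ℝ => (Real.sqrt Real.pi / (2 * k0)) * (1 / Real.sqrt (4 - s ^ 2)))
      MeasureTheory.volume 0 1 := by
    apply ContinuousOn.intervalIntegrable
    apply ContinuousOn.mul continuousOn_const
    apply ContinuousOn.div continuousOn_const (by fun_prop)
    intro s hs
    rw [Set.uIcc_of_le zero_le_one] at hs
    obtain ⟨h0, h1⟩ := hs
    exact (Real.sqrt_pos.2 (by nlinarith)).ne'
  rw [e1, e2, ← intervalIntegral.integral_const_mul, ← intervalIntegral.integral_sub hi1 hi2]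
  have := intervalIntegral.norm_integral_le_of_norm_le_const (a := (0:ℝ)) (b := 1) (C := Real.sqrt t)
    (f := fun s => Real.sqrt t * (∑' m, F m s) - (Real.sqrt Real.pi / (2 * k0)) * (1 / Real.sqrt (4 - s ^ 2))) ?_
  · simpa using this
  intro s hs
  rw [Set.uIoc_of_le zero_le_one] at hs
  have h1 : 3 ≤ 4 - s ^ 2 := by nlinarith [hs.1, hs.2]
  have hβ : 0 < (4 - s ^ 2) * (k0 ^ 2 * t) := by positivity
  have hg := (gauss_sum _ hβ).2
  simp only [hF]
  have e3 : (Real.sqrt Real.pi / (2 * k0)) * (1 / Real.sqrt (4 - s ^ 2)) =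
      Real.sqrt t * (Real.sqrt (Real.pi / ((4 - s ^ 2) * (k0 ^ 2 * t))) / 2) := by
    rw [Real.sqrt_div Real.pi_pos.le, Real.sqrt_mul (by linarith), Real.sqrt_mul (by positivity),
      Real.sqrt_sq hk.le]
    have := (Real.sqrt_pos.2 ht).ne'
    have := (Real.sqrt_pos.2 (show 0 < 4 - s ^ 2 by linarith)).ne'
    field_simp
  rw [e3, ← mul_sub, norm_mul, Real.norm_of_nonneg (Real.sqrt_nonneg _), Real.norm_eq_abs]
  exact mul_le_of_le_one_right (Real.sqrt_nonneg _) hg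

lemma monot_int (t : ℝ) (ht : 0 < t) (a : ℕ) :
    |(∑ b ∈ Finset.range a, Real.exp (t * (b : ℝ) ^ 2)) - ∫ y in (0 : ℝ)..a, Real.exp (t * y ^ 2)|
      ≤ Real.exp (t * (a : ℝ) ^ 2) := by
  have hm : MonotoneOn (fun y : ℝ => Real.exp (t * y ^ 2)) (Set.Icc 0 (0 + a)) := by
    intro x hx y hy hxy
    apply Real.exp_le_exp.2
    have : x ^ 2 ≤ y ^ 2 := pow_le_pow_left₀ hx.1 hxy 2
    nlinarith
  have h1 := hm.sum_le_integral
  have h2 := hm.integral_le_sum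
  simp only [zero_add] at h1 h2
  have h3 := Finset.sum_range_succ' (fun b : ℕ => Real.exp (t * (b : ℝ) ^ 2)) a
  rw [Finset.sum_range_succ] at h3
  simp only [Nat.cast_zero, ne_eq, OfNat.ofNat_ne_zero, not_false_eq_true, zero_pow, mul_zero, Real.exp_zero] at h3
  rw [abs_le]
  constructor
  · linarith
  · linarith [Real.exp_pos (t * (a : ℝ) ^ 2)]

lemma mainf_eq (t : ℝ) (a : ℕ) (ha : 0 < a) :
    Real.exp (-(4 * (a : ℝ) ^ 2 * t)) * (∫ y in (0 : ℝ)..a, Real.exp (t * y ^ 2)) = a * mainf a t := by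
  have ha' : (a : ℝ) ≠ 0 := by positivity
  have h := intervalIntegral.mul_integral_comp_mul_left (a := 0) (b := 1) (f := fun y : ℝ => Real.exp (t * y ^ 2)) (c := (a : ℝ))
  simp only [mul_zero, mul_one] at h
  rw [← h, mainf, mul_left_comm, ← intervalIntegral.integral_const_mul]
  congr 1
  apply intervalIntegral.integral_congr
  intro s _
  simp only
  rw [← Real.exp_add]; ring_nf

lemma abel_sum (d : ℕ → ℂ) (C : ℝ) (hC : ∀ n, ‖∑ b ∈ Finset.range n, d b‖ ≤ C) (g : ℕ → ℝ)
    (hg : Monotone g) (hg0 : 0 ≤ g 0) (a : ℕ) :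
    ‖∑ b ∈ Finset.range a, d b * (g b : ℂ)‖ ≤ 2 * C * g a := by
  have hC0 : 0 ≤ C := (norm_nonneg _).trans (hC 0)
  have h1 : ∀ a : ℕ, ∑ b ∈ Finset.range a, d b * (g b : ℂ) = (∑ b ∈ Finset.range a, d b) * g a -
      ∑ b ∈ Finset.range a, (∑ i ∈ Finset.range (b + 1), d i) * ((g (b + 1) - g b : ℝ) : ℂ) := by
    intro a
    induction a with
    | zero => simp
    | succ n ih =>
      rw [Finset.sum_range_succ, ih, Finset.sum_range_succ (fun b => (∑ i ∈ Finset.range (b + 1), d i) * ((g (b + 1) - g b : ℝ) : ℂ)),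
        Finset.sum_range_succ d n]
      push_cast
      ring
  rw [h1]
  have h2 : ‖∑ b ∈ Finset.range a, (∑ i ∈ Finset.range (b + 1), d i) * ((g (b + 1) - g b : ℝ) : ℂ)‖
      ≤ C * (g a - g 0) := by
    rw [← Finset.sum_range_sub, Finset.mul_sum]
    apply norm_sum_le_of_le
    intro b _
    have := hg (Nat.le_succ b)
    rw [norm_mul, Complex.norm_real, Real.norm_of_nonneg (by simpa using this)]
    exact mul_le_mul_of_nonneg_right (hC _) (by simpa using this)
  have h3 : ‖(∑ b ∈ Finset.range a, d b) * (g a : ℂ)‖ ≤ C * g a := by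
    have := hg (Nat.zero_le a)
    rw [norm_mul, Complex.norm_real, Real.norm_of_nonneg (by linarith)]
    exact mul_le_mul_of_nonneg_right (hC _) (by linarith)
  refine (norm_sub_le _ _).trans ?_
  nlinarith

lemma periodic_partial (k : ℕ) (hk : 0 < k) (d : ℕ → ℂ) (hper : ∀ n, d (n + k) = d n)
    (h0 : ∑ b ∈ Finset.range k, d b = 0) :
    ∃ C : ℝ, ∀ n, ‖∑ b ∈ Finset.range n, d b‖ ≤ C := by
  have h1 : ∀ n, ∑ b ∈ Finset.range (n + k), d b = ∑ b ∈ Finset.range n, d b := by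
    intro n
    rw [add_comm n k, Finset.sum_range_add, h0, zero_add]
    exact Finset.sum_congr rfl (fun b _ => by rw [add_comm, hper])
  refine ⟨∑ m ∈ Finset.range k, ‖∑ b ∈ Finset.range m, d b‖, ?_⟩
  intro n
  induction n using Nat.strong_induction_on with
  | _ n ih =>
    rcases lt_or_ge n k with h | h
    · exact Finset.single_le_sum (f := fun m => ‖∑ b ∈ Finset.range m, d b‖) (fun _ _ => norm_nonneg _) (Finset.mem_range.2 h)
    · have := ih (n - k) (by omega)
      rw [← h1, Nat.sub_add_cancel h] at this
      exact this

lemma recip_bound (x : ℝ) (hx : 0 < x) :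
    0 ≤ 1 / (Real.exp x - 1) ∧ 1 / (Real.exp x - 1) ≤ 1 / x ∧ 1 / x - 1 ≤ 1 / (Real.exp x - 1) := by
  have h1 := Real.add_one_lt_exp hx.ne'
  have h3 : 0 < Real.exp x - 1 := by linarith
  refine ⟨by positivity, one_div_le_one_div_of_le hx (by linarith), ?_⟩
  have h4 : Real.exp x * (1 - x) ≤ 1 := by
    have := Real.add_one_le_exp (-x)
    have h5 : Real.exp x * Real.exp (-x) = 1 := by rw [← Real.exp_add]; simp
    nlinarith [Real.exp_pos x]
  rw [div_sub_one hx.ne', div_le_div_iff₀ hx h3]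
  nlinarith

lemma exp_bound4 (x : ℝ) (hx : 0 < x) : Real.exp (-x) ≤ x ^ (-(1 / 4) : ℝ) := by
  have h1 : x ^ ((1 : ℝ) / 4) ≤ 1 + x := by
    rcases le_total x 1 with h | h
    · have := Real.rpow_le_one hx.le h (show (0 : ℝ) ≤ 1 / 4 by norm_num)
      linarith
    · have := Real.rpow_le_rpow_of_exponent_le h (show (1 : ℝ) / 4 ≤ 1 by norm_num)
      rw [Real.rpow_one] at this
      linarith
  have h2 := Real.add_one_le_exp x
  rw [Real.rpow_neg hx.le, Real.exp_neg]
  have hp : 0 < x ^ ((1 : ℝ) / 4) := Real.rpow_pos_of_pos hx _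
  exact inv_anti₀ hp (by linarith)

end

section
open Filter Topology

noncomputable def qq (h : ℤ) (k : ℕ) (t : ℝ) : ℂ := Complex.exp (2 * Real.pi * Complex.I * h / k - t)

noncomputable def bS (h : ℤ) (k : ℕ) (t : ℝ) (a : ℕ) : ℂ :=
  ∑ b ∈ Finset.Ioo (-(a : ℤ)) a, (qq h k t ^ (b.natAbs ^ 2))⁻¹

noncomputable def Ta (h : ℤ) (k : ℕ) (t : ℝ) (a : ℕ) : ℂ :=
  (qq h k t ^ (4 * a)) ^ (a + 1) / (1 - qq h k t ^ (4 * a)) * bS h k t a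

lemma qq_norm (h : ℤ) (k : ℕ) (t : ℝ) : ‖qq h k t‖ = Real.exp (-t) := by
  rw [qq, Complex.norm_exp]
  congr 1
  have : (2 * Real.pi * Complex.I * h / k - t : ℂ) = ((2 * Real.pi * h / k : ℝ) : ℂ) * Complex.I + ((-t : ℝ) : ℂ) := by
    push_cast; ring
  rw [this, Complex.add_re, Complex.ofReal_re, Complex.re_ofReal_mul]; simp

lemma qq_ne (h : ℤ) (k : ℕ) (t : ℝ) : qq h k t ≠ 0 := Complex.exp_ne_zero _

lemma qq_pow (h : ℤ) (k : ℕ) (t : ℝ) (n : ℕ) :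
    qq h k t ^ n = Complex.exp (2 * Real.pi * Complex.I * (h * n) / k) * (Real.exp (-(t * n)) : ℂ) := by
  rw [qq, ← Complex.exp_nat_mul, Complex.ofReal_exp, ← Complex.exp_add]
  congr 1; push_cast; ring

lemma qq_inv (h : ℤ) (k : ℕ) (t : ℝ) (n : ℕ) :
    (qq h k t ^ (n ^ 2))⁻¹ = Complex.exp (2 * Real.pi * Complex.I * (-(h * (n : ℂ) ^ 2)) / k)
      * ((Real.exp (t * (n : ℝ) ^ 2) : ℝ) : ℂ) := by
  rw [qq_pow, Complex.ofReal_exp, Complex.ofReal_exp, ← Complex.exp_add, ← Complex.exp_add, ← Complex.exp_neg]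
  congr 1; push_cast; ring

lemma Ioo_even (F : ℕ → ℂ) (a : ℕ) :
    ∑ b ∈ Finset.Ioo (-((a + 1 : ℕ) : ℤ)) ((a + 1 : ℕ) : ℤ), F b.natAbs = 2 * ∑ b ∈ Finset.range (a + 1), F b - F 0 := by
  induction a with
  | zero =>
    have : Finset.Ioo (-((0 + 1 : ℕ) : ℤ)) ((0 + 1 : ℕ) : ℤ) = {0} := by
      ext x; simp only [Finset.mem_Ioo, Finset.mem_singleton]; omega
    rw [this]; simp; ring
  | succ n ih =>
    have e : Finset.Ioo (-((n + 1 + 1 : ℕ) : ℤ)) ((n + 1 + 1 : ℕ) : ℤ) =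
        insert (-((n + 1 : ℕ) : ℤ)) (insert (((n + 1 : ℕ) : ℤ)) (Finset.Ioo (-((n + 1 : ℕ) : ℤ)) ((n + 1 : ℕ) : ℤ))) := by
      ext x; simp only [Finset.mem_Ioo, Finset.mem_insert]; omega
    rw [e, Finset.sum_insert, Finset.sum_insert, ih, Finset.sum_range_succ _ (n + 1)]
    · rw [Int.natAbs_neg, Int.natAbs_natCast]; ring
    · simp
    · simp only [Finset.mem_insert, Finset.mem_Ioo]; omega

lemma chi_per (h : ℤ) (k : ℕ) (hk : 0 < k) (b : ℕ) :
    Complex.exp (2 * Real.pi * Complex.I * (-(h * ((b + k : ℕ) : ℂ) ^ 2)) / k) =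
    Complex.exp (2 * Real.pi * Complex.I * (-(h * (b : ℂ) ^ 2)) / k) := by
  rw [Complex.exp_eq_exp_iff_exists_int]
  refine ⟨-(h * (2 * b + k)), ?_⟩
  have : (k : ℂ) ≠ 0 := by exact_mod_cast hk.ne'
  push_cast
  field_simp
  ring

lemma bS_main (h : ℤ) (k : ℕ) (hk : 0 < k) : ∃ C : ℝ, 0 ≤ C ∧ ∀ t : ℝ, 0 < t → ∀ a : ℕ, 0 < a →
    ‖bS h k t a - 2 * (gG h k / k) * ((∫ y in (0 : ℝ)..a, Real.exp (t * y ^ 2) : ℝ) : ℂ)‖ ≤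
      C * Real.exp (t * (a : ℝ) ^ 2) := by
  set μ : ℂ := gG h k / k with hμ
  let χ : ℕ → ℂ := fun b => Complex.exp (2 * Real.pi * Complex.I * (-(h * (b : ℂ) ^ 2)) / k)
  have hkc : (k : ℂ) ≠ 0 := by exact_mod_cast hk.ne'
  obtain ⟨C0, hC0⟩ := periodic_partial k hk (fun b => χ b - μ) (fun n => by simp only [χ]; rw [chi_per h k hk])
    (by
      rw [Finset.sum_sub_distrib, Finset.sum_const, Finset.card_range, nsmul_eq_mul, hμ,
        mul_div_cancel₀ _ hkc]
      exact sub_self _)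
  have hC0' : 0 ≤ C0 := (norm_nonneg _).trans (hC0 0)
  refine ⟨2 * (2 * C0) + 2 * ‖μ‖ + 1, by positivity, ?_⟩
  intro t ht a ha
  obtain ⟨a, rfl⟩ : ∃ n, a = n + 1 := ⟨a - 1, by omega⟩
  set G := Real.exp (t * ((a + 1 : ℕ) : ℝ) ^ 2) with hG
  set I := ∫ y in (0 : ℝ)..((a + 1 : ℕ) : ℝ), Real.exp (t * y ^ 2) with hI
  have hG1 : 1 ≤ G := Real.one_le_exp (by positivity)
  have e1 : bS h k t (a + 1) = 2 * ∑ b ∈ Finset.range (a + 1), χ b * ((Real.exp (t * (b : ℝ) ^ 2) : ℝ) : ℂ) - 1 := by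
    rw [bS, Ioo_even (fun n => (qq h k t ^ (n ^ 2))⁻¹)]
    simp only [qq_inv]
    simp [χ]
  have h1 := abel_sum (fun b => χ b - μ) C0 hC0 (fun b => Real.exp (t * (b : ℝ) ^ 2)) (by
    intro m n hmn
    apply Real.exp_le_exp.2
    have : (m : ℝ) ≤ n := by exact_mod_cast hmn
    gcongr) (Real.exp_pos _).le (a + 1)
  have h2 := monot_int t ht (a + 1)
  rw [← hG, ← hI] at h2
  rw [← hG] at h1
  set S := ∑ b ∈ Finset.range (a + 1), Real.exp (t * (b : ℝ) ^ 2) with hS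
  have e2 : bS h k t (a + 1) - 2 * μ * (I : ℂ) =
      2 * (∑ b ∈ Finset.range (a + 1), (χ b - μ) * ((Real.exp (t * (b : ℝ) ^ 2) : ℝ) : ℂ))
        + 2 * μ * ((S - I : ℝ) : ℂ) - 1 := by
    rw [e1]
    simp only [sub_mul, Finset.sum_sub_distrib, ← Finset.mul_sum]
    rw [hS]; push_cast; ring
  rw [e2]
  refine (norm_sub_le _ _).trans ?_
  have h3 : ‖2 * μ * ((S - I : ℝ) : ℂ)‖ ≤ 2 * ‖μ‖ * G := by
    rw [norm_mul, norm_mul, Complex.norm_real, Real.norm_eq_abs]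
    simp only [Complex.norm_ofNat]
    gcongr
  have h4 := norm_add_le (2 * (∑ b ∈ Finset.range (a + 1), (χ b - μ) * ((Real.exp (t * (b : ℝ) ^ 2) : ℝ) : ℂ))) (2 * μ * ((S - I : ℝ) : ℂ))
  rw [norm_mul, Complex.norm_ofNat] at h4
  rw [norm_one]
  nlinarith

lemma bS_triv (h : ℤ) (k : ℕ) (t : ℝ) (ht : 0 < t) (a : ℕ) :
    ‖bS h k t a‖ ≤ 2 * a * Real.exp (t * (a : ℝ) ^ 2) := by
  have h1 : ‖bS h k t a‖ ≤ ∑ b ∈ Finset.Ioo (-(a : ℤ)) a, Real.exp (t * (a : ℝ) ^ 2) := by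
    apply norm_sum_le_of_le
    intro b hb
    rw [Finset.mem_Ioo] at hb
    rw [norm_inv, norm_pow, qq_norm, ← Real.exp_nat_mul, ← Real.exp_neg]
    apply Real.exp_le_exp.2
    have : b.natAbs ≤ a := by omega
    have : (b.natAbs : ℝ) ≤ a := by exact_mod_cast this
    push_cast
    have := pow_le_pow_left₀ (Nat.cast_nonneg _) this 2
    nlinarith
  refine h1.trans ?_
  rw [Finset.sum_const, nsmul_eq_mul]
  apply mul_le_mul_of_nonneg_right _ (Real.exp_pos _).le
  rw [Int.card_Ioo]
  have : ((a : ℤ) - -(a : ℤ) - 1).toNat ≤ 2 * a := by omega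
  exact_mod_cast this

lemma final_bound (t : ℝ) (ht : 0 < t) (a : ℕ) (ha : 0 < a) :
    a * Real.exp (-(3 * (a : ℝ) ^ 2 * t)) ≤ 2 * ((a : ℝ) ^ (-(3 / 2) : ℝ) * t ^ (-(5 / 4) : ℝ)) ∧
    1 / (a * t) * Real.exp (-(3 * (a : ℝ) ^ 2 * t)) ≤ (a : ℝ) ^ (-(3 / 2) : ℝ) * t ^ (-(5 / 4) : ℝ) := by
  have ha' : (0 : ℝ) < a := by exact_mod_cast ha
  have h0 : Real.exp (-(3 * (a : ℝ) ^ 2 * t)) ≤ Real.exp (-((a : ℝ) ^ 2 * t)) := by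
    apply Real.exp_le_exp.2
    have : 0 < (a : ℝ) ^ 2 * t := by positivity
    nlinarith
  have h1 := exp_bound ((a : ℝ) ^ 2 * t) (by positivity)
  have h2 := exp_bound4 ((a : ℝ) ^ 2 * t) (by positivity)
  have e1 : (a : ℝ) * ((a : ℝ) ^ 2 * t) ^ (-(5 / 4) : ℝ) = (a : ℝ) ^ (-(3 / 2) : ℝ) * t ^ (-(5 / 4) : ℝ) := by
    rw [Real.mul_rpow (by positivity) ht.le, ← Real.rpow_natCast, ← Real.rpow_mul ha'.le, ← mul_assoc]
    congr 1
    nth_rewrite 1 [← Real.rpow_one (a : ℝ)]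
    rw [← Real.rpow_add ha']; norm_num
  have e2 : 1 / (a * t) * ((a : ℝ) ^ 2 * t) ^ (-(1 / 4) : ℝ) = (a : ℝ) ^ (-(3 / 2) : ℝ) * t ^ (-(5 / 4) : ℝ) := by
    rw [Real.mul_rpow (by positivity) ht.le, ← Real.rpow_natCast, ← Real.rpow_mul ha'.le]
    have e3 : 1 / ((a : ℝ) * t) = (a : ℝ) ^ (-1 : ℝ) * t ^ (-1 : ℝ) := by
      rw [Real.rpow_neg_one, Real.rpow_neg_one]; field_simp
    rw [e3, mul_mul_mul_comm, ← Real.rpow_add ha', ← Real.rpow_add ht]; norm_num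
  constructor
  · rw [← e1]; nlinarith [h0.trans h1]
  · rw [← e2]; exact mul_le_mul_of_nonneg_left (h0.trans h2) (by positivity)

lemma caseA (h : ℤ) (k : ℕ) (hk : 0 < k) (hco : Int.gcd h k = 1) : ∃ C : ℝ, 0 ≤ C ∧ ∀ t : ℝ, 0 < t → ∀ a : ℕ, 0 < a →
    ¬ k ∣ 4 * a → ‖Ta h k t a‖ ≤ C * ((a : ℝ) ^ (-(3 / 2) : ℝ) * t ^ (-(5 / 4) : ℝ)) := by
  let ζ : ℕ → ℂ := fun n => Complex.exp (2 * Real.pi * Complex.I * (h * n) / k)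
  have hkc : (k : ℂ) ≠ 0 := by exact_mod_cast hk.ne'
  have hper : ∀ n, ζ (n % k) = ζ n := by
    intro n
    simp only [ζ]
    rw [Complex.exp_eq_exp_iff_exists_int]
    obtain ⟨m, hm⟩ : ∃ m : ℕ, m = n / k := ⟨_, rfl⟩
    refine ⟨-(h * m), ?_⟩
    have : (n : ℂ) = k * m + (n % k : ℕ) := by rw [hm]; exact_mod_cast (Nat.div_add_mod n k).symm
    rw [this]
    push_cast
    field_simp
    ring_nf
  set C0 := ∑ j ∈ Finset.range k, ‖(1 - ζ j)⁻¹‖ with hC0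
  have hC00 : 0 ≤ C0 := Finset.sum_nonneg (fun _ _ => norm_nonneg _)
  have hz : ∀ n, ‖(1 - ζ n)⁻¹‖ ≤ C0 := by
    intro n
    rw [← hper]
    exact Finset.single_le_sum (f := fun j => ‖(1 - ζ j)⁻¹‖) (fun _ _ => norm_nonneg _)
      (Finset.mem_range.2 (Nat.mod_lt _ hk))
  have hne : ∀ n, ¬ k ∣ n → ζ n ≠ 1 := by
    intro n hn h1
    simp only [ζ] at h1
    rw [Complex.exp_eq_one_iff] at h1
    obtain ⟨m, hm⟩ := h1
    have h2 : (h : ℂ) * n = m * k := by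
      have := Complex.two_pi_I_ne_zero
      field_simp at hm
      rw [hm]; ring
    have h3 : h * n = m * k := by exact_mod_cast h2
    have h4 : (k : ℤ) ∣ h * n := ⟨m, by rw [h3]; ring⟩
    have h5 : (k : ℤ) ∣ n := by
      refine IsCoprime.dvd_of_dvd_mul_left ?_ h4
      rw [Int.isCoprime_iff_gcd_eq_one, Int.gcd_comm]; exact hco
    exact hn (by exact_mod_cast h5)
  have hzn : ∀ n, ‖ζ n‖ = 1 := by
    intro n
    simp only [ζ]
    have : (2 * Real.pi * Complex.I * (h * n) / k : ℂ) = ((2 * Real.pi * (h * n) / k : ℝ) : ℂ) * Complex.I := by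
      push_cast; ring
    rw [this, Complex.norm_exp_ofReal_mul_I]
  refine ⟨8 * C0, by positivity, ?_⟩
  intro t ht a ha hd
  have ha' : (0 : ℝ) < a := by exact_mod_cast ha
  set ρ := Real.exp (-(t * (4 * a : ℕ))) with hρ
  have hq : qq h k t ^ (4 * a) = ζ (4 * a) * (ρ : ℂ) := qq_pow h k t (4 * a)
  have hρ0 : 0 < ρ := Real.exp_pos _
  have hρ1 : ρ ≤ 1 := Real.exp_le_one_iff.2 (neg_nonpos.2 (by positivity))
  have hden : ‖(1 - qq h k t ^ (4 * a))⁻¹‖ ≤ 2 * C0 := by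
    have h1 : 0 < ‖1 - ζ (4 * a)‖ := norm_pos_iff.2 (sub_ne_zero.2 (hne _ hd).symm)
    have h2 : ‖1 - ζ (4 * a)‖ ≤ 2 * ‖1 - ζ (4 * a) * (ρ : ℂ)‖ := by
      have e : 1 - ζ (4 * a) = (1 - ζ (4 * a) * (ρ : ℂ)) - ((1 - ρ : ℝ) : ℂ) * ζ (4 * a) := by push_cast; ring
      have h3 : ‖1 - ζ (4 * a)‖ ≤ ‖1 - ζ (4 * a) * (ρ : ℂ)‖ + ‖((1 - ρ : ℝ) : ℂ) * ζ (4 * a)‖ := by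
        conv_lhs => rw [e]
        exact norm_sub_le _ _
      rw [norm_mul, hzn, Complex.norm_real, Real.norm_of_nonneg (by linarith), mul_one] at h3
      have h4 := norm_sub_norm_le (1 : ℂ) (ζ (4 * a) * (ρ : ℂ))
      rw [norm_mul, hzn, Complex.norm_real, Real.norm_of_nonneg hρ0.le, norm_one, one_mul] at h4
      linarith
    have h5 := hz (4 * a)
    rw [norm_inv] at h5 ⊢
    rw [hq]
    have h6 : ‖1 - ζ (4 * a) * (ρ : ℂ)‖⁻¹ ≤ (‖1 - ζ (4 * a)‖ / 2)⁻¹ := inv_anti₀ (by positivity) (by linarith)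
    rw [inv_div, div_eq_mul_inv] at h6
    linarith
  have hnum : ‖(qq h k t ^ (4 * a)) ^ (a + 1)‖ ≤ Real.exp (-(4 * (a : ℝ) ^ 2 * t)) := by
    rw [norm_pow, norm_pow, qq_norm, ← pow_mul, ← Real.exp_nat_mul]
    apply Real.exp_le_exp.2
    push_cast
    nlinarith [mul_pos ha' ht]
  have hb := bS_triv h k t ht a
  have hf := (final_bound t ht a ha).1
  rw [Ta, div_eq_mul_inv, norm_mul, norm_mul]
  calc _ ≤ Real.exp (-(4 * (a : ℝ) ^ 2 * t)) * (2 * C0) * (2 * a * Real.exp (t * (a : ℝ) ^ 2)) := by gcongr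
    _ = 4 * C0 * (a * Real.exp (-(3 * (a : ℝ) ^ 2 * t))) := by
      have : Real.exp (-(3 * (a : ℝ) ^ 2 * t)) = Real.exp (-(4 * (a : ℝ) ^ 2 * t)) * Real.exp (t * (a : ℝ) ^ 2) := by
        rw [← Real.exp_add]; ring_nf
      rw [this]; ring
    _ ≤ 4 * C0 * (2 * ((a : ℝ) ^ (-(3 / 2) : ℝ) * t ^ (-(5 / 4) : ℝ))) := by gcongr
    _ = _ := by ring

lemma caseB (h : ℤ) (k : ℕ) (hk : 0 < k) : ∃ C : ℝ, 0 ≤ C ∧ ∀ t : ℝ, 0 < t → ∀ a : ℕ, 0 < a →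
    k ∣ 4 * a → ‖Ta h k t a - (gG h k / k) * ((1 / (2 * t) * mainf a t : ℝ) : ℂ)‖
      ≤ C * ((a : ℝ) ^ (-(3 / 2) : ℝ) * t ^ (-(5 / 4) : ℝ)) := by
  obtain ⟨C0, hC0, hbS⟩ := bS_main h k hk
  set μ : ℂ := gG h k / k with hμ
  have hkc : (k : ℂ) ≠ 0 := by exact_mod_cast hk.ne'
  refine ⟨4 * ‖μ‖ + C0, by positivity, ?_⟩
  intro t ht a ha hd
  have ha' : (0 : ℝ) < a := by exact_mod_cast ha
  have hac : (a : ℂ) ≠ 0 := by exact_mod_cast ha.ne'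
  have hq : qq h k t ^ (4 * a) = ((Real.exp (-(4 * a * t)) : ℝ) : ℂ) := by
    rw [qq_pow]
    obtain ⟨m, hm⟩ := hd
    have : Complex.exp (2 * Real.pi * Complex.I * (h * (4 * a : ℕ)) / k) = 1 := by
      rw [Complex.exp_eq_one_iff]
      refine ⟨h * m, ?_⟩
      rw [hm]; push_cast; field_simp
    rw [this, one_mul]; push_cast; ring_nf
  set x := 4 * (a : ℝ) * t with hx
  have hx0 : 0 < x := by positivity
  set R := 1 / (Real.exp x - 1) with hR
  have hR' := recip_bound x hx0
  rw [← hR] at hR'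
  have hex : 1 < Real.exp x := Real.one_lt_exp_iff.2 hx0
  have hfac : (qq h k t ^ (4 * a)) ^ (a + 1) / (1 - qq h k t ^ (4 * a)) =
      ((Real.exp (-(4 * (a : ℝ) ^ 2 * t)) * R : ℝ) : ℂ) := by
    rw [hq, ← Complex.ofReal_pow, ← Complex.ofReal_one, ← Complex.ofReal_sub, ← Complex.ofReal_div]
    congr 1
    have e1 : Real.exp (-x) ^ (a + 1) = Real.exp (-(4 * (a : ℝ) ^ 2 * t)) * Real.exp (-x) := by
      rw [← Real.exp_nat_mul, ← Real.exp_add]; congr 1; push_cast; rw [hx]; ring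
    rw [e1, hR, Real.exp_neg x]
    have : Real.exp x - 1 ≠ 0 := by linarith
    have h2 := Real.exp_pos x
    have h3 : 1 - (Real.exp x)⁻¹ ≠ 0 := by
      have := inv_lt_one_of_one_lt₀ hex
      linarith
    rw [mul_div_assoc]
    congr 1
    rw [div_eq_div_iff h3 this]
    field_simp
  set I := ∫ y in (0 : ℝ)..a, Real.exp (t * y ^ 2) with hI
  have hmf := mainf_eq t a ha
  rw [← hI] at hmf
  set E := Real.exp (-(4 * (a : ℝ) ^ 2 * t)) with hE
  have hE0 : 0 < E := Real.exp_pos _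
  have hb := hbS t ht a ha
  rw [← hI] at hb
  have hI0 : 0 ≤ I := intervalIntegral.integral_nonneg ha'.le (fun _ _ => (Real.exp_pos _).le)
  set G := Real.exp (t * (a : ℝ) ^ 2) with hG
  have hI1 : I ≤ a * G := by
    have := intervalIntegral.norm_integral_le_of_norm_le_const (a := (0:ℝ)) (b := a) (C := G)
      (f := fun y => Real.exp (t * y ^ 2)) (by
        intro y hy
        rw [Set.uIoc_of_le ha'.le] at hy
        rw [Real.norm_of_nonneg (Real.exp_pos _).le]
        apply Real.exp_le_exp.2
        have := pow_le_pow_left₀ hy.1.le hy.2 2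
        nlinarith)
    rw [Real.norm_eq_abs, sub_zero, abs_of_pos ha'] at this
    exact (le_abs_self _).trans (by linarith)
  have e2 : 1 / (2 * t) * mainf a t = 2 * (E * (1 / x) * I) := by
    have : mainf a t = E * I / a := by rw [hmf]; field_simp
    rw [this, hx]; field_simp; ring
  have e3 : Ta h k t a - μ * ((1 / (2 * t) * mainf a t : ℝ) : ℂ) =
      ((E * R : ℝ) : ℂ) * (bS h k t a - 2 * μ * (I : ℂ)) - 2 * μ * ((E * (1 / x - R) * I : ℝ) : ℂ) := by
    rw [Ta, hfac, e2]; push_cast; ring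
  rw [e3]
  have hEG : E * G = Real.exp (-(3 * (a : ℝ) ^ 2 * t)) := by
    rw [hE, hG, ← Real.exp_add]; ring_nf
  obtain ⟨f1, f2⟩ := final_bound t ht a ha
  rw [← hEG] at f1 f2
  set B := (a : ℝ) ^ (-(3 / 2) : ℝ) * t ^ (-(5 / 4) : ℝ) with hB
  refine (norm_sub_le _ _).trans ?_
  have g1 : ‖((E * R : ℝ) : ℂ) * (bS h k t a - 2 * μ * (I : ℂ))‖ ≤ C0 * B := by
    rw [norm_mul, Complex.norm_real, Real.norm_of_nonneg (mul_nonneg hE0.le hR'.1)]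
    calc _ ≤ E * (1 / (a * t)) * (C0 * G) := by
          have : 1 / x ≤ 1 / (a * t) := one_div_le_one_div_of_le (by positivity) (by rw [hx]; nlinarith [mul_pos ha' ht])
          have := hR'.2.1.trans this
          gcongr
      _ = C0 * (1 / (a * t) * (E * G)) := by ring
      _ ≤ _ := by gcongr
  have g2 : ‖2 * μ * ((E * (1 / x - R) * I : ℝ) : ℂ)‖ ≤ 4 * ‖μ‖ * B := by
    have hd0 : 0 ≤ 1 / x - R := by linarith [hR'.2.1]
    rw [norm_mul, norm_mul, Complex.norm_real, Real.norm_of_nonneg (by positivity), Complex.norm_ofNat]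
    calc _ ≤ 2 * ‖μ‖ * (E * 1 * (a * G)) := by
          have : 1 / x - R ≤ 1 := by linarith [hR'.2.2]
          gcongr
      _ = 2 * ‖μ‖ * (a * (E * G)) := by ring
      _ ≤ 2 * ‖μ‖ * (2 * B) := by gcongr
      _ = _ := by ring
  linarith

end

section
open Filter Topology

abbrev SIdx := Σ a : ℕ, ({b : ℤ // b ∈ Finset.Ioo (-(a : ℤ)) a} × ℕ)

def strEquiv : SIdx ≃ Str where
  toFun p := ⟨((p.1 : ℤ), p.2.1.1, (p.1 : ℤ) + 1 + p.2.2), by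
    obtain ⟨a, ⟨b, hb⟩, j⟩ := p
    rw [Finset.mem_Ioo] at hb
    refine ⟨abs_lt.2 hb, ?_⟩
    simp only
    omega⟩
  invFun Q := ⟨Q.1.1.toNat, ⟨⟨Q.1.2.1, by
    obtain ⟨⟨a, b, c⟩, h1, h2⟩ := Q
    change |b| < a at h1
    change b ∈ Finset.Ioo (-((a.toNat : ℕ) : ℤ)) ((a.toNat : ℕ) : ℤ)
    have h3 : 0 < a := lt_of_le_of_lt (abs_nonneg b) h1
    rw [abs_lt] at h1
    rw [Finset.mem_Ioo]
    omega⟩, (Q.1.2.2 - Q.1.1 - 1).toNat⟩⟩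
  left_inv p := by
    obtain ⟨a, ⟨b, hb⟩, j⟩ := p
    have e : ((a : ℤ) + 1 + (j : ℤ) - (a : ℤ) - 1).toNat = j := by omega
    simp only [Int.toNat_natCast, e]
  right_inv Q := by
    obtain ⟨⟨a, b, c⟩, h1, h2⟩ := Q
    have h3 : 0 < a := lt_of_le_of_lt (abs_nonneg b) h1
    change a < c at h2
    apply Subtype.ext
    simp only [Prod.mk.injEq]
    refine ⟨by omega, trivial, by omega⟩

lemma str_term (q : ℂ) (hq : q ≠ 0) (p : SIdx) :
    q ^ qD (strEquiv p).1 = (q ^ (4 * p.1)) ^ (p.1 + 1) * (q ^ (p.2.1.1.natAbs ^ 2))⁻¹ * (q ^ (4 * p.1)) ^ p.2.2 := by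
  have hw := (qD_ge (StrictRed.weak (strEquiv p).2)).2
  obtain ⟨a, ⟨b, hb⟩, j⟩ := p
  simp only [strEquiv, Equiv.coe_fn_mk, formDisc] at hw ⊢
  have hb2 : ((b.natAbs ^ 2 : ℕ) : ℤ) = b ^ 2 := by push_cast; exact sq_abs b
  have h1 : qD ((a : ℤ), b, (a : ℤ) + 1 + j) + b.natAbs ^ 2 = 4 * a * (a + 1) + 4 * a * j := by
    zify; rw [hw]; push_cast at hb2; rw [sq_abs]; ring
  have h2 : q ^ (b.natAbs ^ 2) ≠ 0 := pow_ne_zero _ hq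
  rw [← pow_mul, ← pow_mul]
  field_simp
  rw [← pow_add, ← pow_add, h1]

lemma str_sum (h : ℤ) (k : ℕ) (t : ℝ) (ht : 0 < t) :
    HasSum (fun a => Ta h k t a) (∑' Q : Str, qq h k t ^ qD Q.1) := by
  set q := qq h k t with hq
  have hr1 : ‖q‖ < 1 := by rw [hq, qq_norm, Real.exp_lt_one_iff]; linarith
  have hs : Summable (fun Q : Str => q ^ qD Q.1) := by
    apply Summable.of_norm
    simp only [norm_pow]
    exact summable_weak ‖q‖ (norm_nonneg _) hr1 StrictRed (fun Q hQ => hQ.weak)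
  have h1 : HasSum (fun p : SIdx => q ^ qD (strEquiv p).1) (∑' Q : Str, q ^ qD Q.1) :=
    (strEquiv.hasSum_iff (f := fun Q : Str => q ^ qD Q.1)).2 hs.hasSum
  refine h1.sigma ?_
  intro a
  have h2 : Summable (fun x : {b : ℤ // b ∈ Finset.Ioo (-(a : ℤ)) a} × ℕ => q ^ qD (strEquiv ⟨a, x⟩).1) :=
    h1.summable.sigma_factor a
  rcases Nat.eq_zero_or_pos a with rfl | ha
  · have : Ta h k t 0 = 0 := by simp [Ta, bS]
    rw [this]
    have : IsEmpty ({b : ℤ // b ∈ Finset.Ioo (-((0 : ℕ) : ℤ)) ((0 : ℕ) : ℤ)} × ℕ) := by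
      constructor; rintro ⟨⟨b, hb⟩, _⟩; rw [Finset.mem_Ioo] at hb; omega
    exact hasSum_empty
  have hra : ‖q ^ (4 * a)‖ < 1 := by
    rw [norm_pow]; exact pow_lt_one₀ (norm_nonneg _) hr1 (by omega)
  have h3 : ∀ b : {b : ℤ // b ∈ Finset.Ioo (-(a : ℤ)) a}, HasSum (fun j : ℕ => q ^ qD (strEquiv ⟨a, (b, j)⟩).1)
      ((q ^ (4 * a)) ^ (a + 1) * (q ^ (b.1.natAbs ^ 2))⁻¹ * (1 - q ^ (4 * a))⁻¹) := by
    intro b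
    simp only [str_term q (qq_ne h k t)]
    exact (hasSum_geometric_of_norm_lt_one hra).mul_left _
  have h4 := h2.hasSum.prod_fiberwise h3
  have h5 : Ta h k t a = ∑ b : {b : ℤ // b ∈ Finset.Ioo (-(a : ℤ)) a}, (q ^ (4 * a)) ^ (a + 1) * (q ^ (b.1.natAbs ^ 2))⁻¹ * (1 - q ^ (4 * a))⁻¹ := by
    rw [Ta, bS, ← hq, ← Finset.sum_coe_sort, Finset.mul_sum]
    exact Finset.sum_congr rfl (fun b _ => by rw [div_eq_mul_inv]; ring)
  rw [h5, ← h4.unique (hasSum_fintype _)]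
  exact h2.hasSum

lemma str_lim (h : ℤ) (k : ℕ) (hk : 0 < k) (hco : Int.gcd h k = 1) (k0 : ℕ) (hk0 : 0 < k0)
    (hk0' : ∀ a, k ∣ 4 * a ↔ k0 ∣ a) :
    ∃ C : ℝ, ∀ t : ℝ, 0 < t →
      ‖(∑' Q : Str, qq h k t ^ qD Q.1)
        - (gG h k / k) * ((1 / (2 * t) * ∑' m : ℕ, mainf ((k0 * (m + 1) : ℕ) : ℝ) t : ℝ) : ℂ)‖
      ≤ C * t ^ (-(5 / 4) : ℝ) := by
  classical
  obtain ⟨CA, hCA0, hCA⟩ := caseA h k hk hco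
  obtain ⟨CB, hCB0, hCB⟩ := caseB h k hk
  set μ : ℂ := gG h k / k with hμ
  have hsum : Summable (fun a : ℕ => (a : ℝ) ^ (-(3 / 2) : ℝ)) := Real.summable_nat_rpow.2 (by norm_num)
  refine ⟨(CA + CB) * ∑' a : ℕ, (a : ℝ) ^ (-(3 / 2) : ℝ), ?_⟩
  intro t ht
  let M : ℕ → ℂ := fun a => if k0 ∣ a ∧ a ≠ 0 then ((1 / (2 * t) * mainf a t : ℝ) : ℂ) else 0
  have hinj : Function.Injective (fun m : ℕ => k0 * (m + 1)) := by
    intro m n hmn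
    have := Nat.eq_of_mul_eq_mul_left hk0 hmn
    omega
  have hM : HasSum M ((1 / (2 * t) * ∑' m : ℕ, mainf ((k0 * (m + 1) : ℕ) : ℝ) t : ℝ) : ℂ) := by
    rw [← hinj.hasSum_iff]
    · have h1 := ((mainf_bound k0 hk0 t ht).1.hasSum.mul_left (1 / (2 * t)))
      have h2 := Complex.hasSum_ofReal.2 h1
      refine h2.congr_fun ?_
      intro m
      simp only [Function.comp, M]
      rw [if_pos ⟨dvd_mul_right _ _, by positivity⟩]
    · intro a ha
      simp only [M]
      rw [if_neg]
      rintro ⟨⟨m, hm⟩, h0⟩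
      apply ha
      refine ⟨m - 1, ?_⟩
      simp only
      have : m ≠ 0 := by rintro rfl; simp at hm; exact h0 hm
      rw [Nat.sub_add_cancel (by omega), hm]
  have hT := (str_sum h k t ht).sub (hM.mul_left μ)
  rw [← hT.tsum_eq]
  have hb : ∀ a : ℕ, ‖Ta h k t a - μ * M a‖ ≤ (CA + CB) * t ^ (-(5 / 4) : ℝ) * (a : ℝ) ^ (-(3 / 2) : ℝ) := by
    intro a
    have ht' : 0 ≤ t ^ (-(5 / 4) : ℝ) := Real.rpow_nonneg ht.le _
    have ha' : 0 ≤ (a : ℝ) ^ (-(3 / 2) : ℝ) := Real.rpow_nonneg (Nat.cast_nonneg _) _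
    have hpos := mul_nonneg ha' ht'
    rcases Nat.eq_zero_or_pos a with rfl | ha
    · have e : Ta h k t 0 - μ * M 0 = 0 := by simp [Ta, bS, M]
      rw [e, norm_zero]; positivity
    by_cases hd : k ∣ 4 * a
    · have e : M a = ((1 / (2 * t) * mainf a t : ℝ) : ℂ) := by
        simp only [M]; rw [if_pos ⟨(hk0' a).1 hd, by omega⟩]
      rw [e]
      have := hCB t ht a ha hd
      nlinarith [mul_nonneg hCA0 hpos]
    · have e : M a = 0 := by
        simp only [M]; rw [if_neg]; rintro ⟨h1, _⟩; exact hd ((hk0' a).2 h1)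
      rw [e, mul_zero, sub_zero]
      have := hCA t ht a ha hd
      nlinarith [mul_nonneg hCB0 hpos]
  have := tsum_of_norm_bounded (hsum.hasSum.mul_left ((CA + CB) * t ^ (-(5 / 4) : ℝ))) hb
  refine this.trans (le_of_eq (by ring))

end

section
open Filter Topology

lemma incGamma_bound (y : ℝ) (hy : 0 < y) :
    ‖incGamma (-(1 / 2)) y‖ ≤ 2 * y ^ (-(1 / 2) : ℝ) * Real.exp (-y) := by
  have e1 : (-(1 / 2) - 1 : ℝ) = -(3 / 2) := by norm_num
  have h1 := integral_Ioi_rpow_of_lt (a := -(3 / 2)) (by norm_num) hy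
  have h2 := integrableOn_Ioi_rpow_of_lt (a := -(3 / 2)) (by norm_num) hy
  rw [incGamma, e1]
  have h3 : ‖∫ t in Set.Ioi y, t ^ (-(3 / 2) : ℝ) * Real.exp (-t)‖ ≤
      ∫ t in Set.Ioi y, t ^ (-(3 / 2) : ℝ) * Real.exp (-y) := by
    refine MeasureTheory.norm_integral_le_of_norm_le (h2.mul_const _) ?_
    filter_upwards [MeasureTheory.ae_restrict_mem measurableSet_Ioi] with t ht
    have ht0 : 0 < t := lt_trans hy ht
    rw [norm_mul, Real.norm_of_nonneg (Real.rpow_nonneg ht0.le _), Real.norm_of_nonneg (Real.exp_pos _).le]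
    have : Real.exp (-t) ≤ Real.exp (-y) := Real.exp_le_exp.2 (neg_le_neg (le_of_lt ht))
    exact mul_le_mul_of_nonneg_left this (Real.rpow_nonneg ht0.le _)
  refine h3.trans (le_of_eq ?_)
  rw [MeasureTheory.integral_mul_const, h1]
  norm_num
  ring

lemma exp_bound34 (x : ℝ) (hx : 0 < x) : Real.exp (-x) ≤ x ^ (-(3 / 4) : ℝ) := by
  have h1 : x ^ ((3 : ℝ) / 4) ≤ 1 + x := by
    rcases le_total x 1 with h | h
    · have := Real.rpow_le_one hx.le h (show (0 : ℝ) ≤ 3 / 4 by norm_num)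
      linarith
    · have := Real.rpow_le_rpow_of_exponent_le h (show (3 : ℝ) / 4 ≤ 1 by norm_num)
      rw [Real.rpow_one] at this
      linarith
  have h2 := Real.add_one_le_exp x
  rw [Real.rpow_neg hx.le, Real.exp_neg]
  have hp : 0 < x ^ ((3 : ℝ) / 4) := Real.rpow_pos_of_pos hx _
  exact inv_anti₀ hp (by linarith)

lemma nonhol_bound : ∃ C : ℝ, 0 ≤ C ∧ ∀ τ : ℂ, 0 < τ.im →
    ‖∑' n : ℕ, (((n : ℂ) + 1) *
        ((incGamma (-(1 / 2)) (4 * Real.pi * ((n : ℝ) + 1) ^ 2 * τ.im) : ℝ) : ℂ) *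
        Complex.exp (2 * Real.pi * Complex.I * (-(((n : ℂ) + 1) ^ 2)) * τ))‖ ≤ C * τ.im ^ (-(5 / 4) : ℝ) := by
  have hsum0 : Summable (fun a : ℕ => (a : ℝ) ^ (-(3 / 2) : ℝ)) := Real.summable_nat_rpow.2 (by norm_num)
  have hsum : Summable (fun a : ℕ => ((a : ℝ) + 1) ^ (-(3 / 2) : ℝ)) := by
    have := (summable_nat_add_iff 1).2 hsum0
    simpa using this
  refine ⟨2 * ∑' a : ℕ, ((a : ℝ) + 1) ^ (-(3 / 2) : ℝ), mul_nonneg (by norm_num)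
    (tsum_nonneg fun a => Real.rpow_nonneg (by positivity) _), ?_⟩
  intro τ hv
  set v := τ.im with hvd
  have hb : ∀ n : ℕ, ‖((n : ℂ) + 1) *
        ((incGamma (-(1 / 2)) (4 * Real.pi * ((n : ℝ) + 1) ^ 2 * v) : ℝ) : ℂ) *
        Complex.exp (2 * Real.pi * Complex.I * (-(((n : ℂ) + 1) ^ 2)) * τ)‖ ≤
      2 * v ^ (-(5 / 4) : ℝ) * ((n : ℝ) + 1) ^ (-(3 / 2) : ℝ) := by
    intro n
    have hN : (0 : ℝ) < (n : ℝ) + 1 := by positivity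
    obtain ⟨N, hNd⟩ : ∃ N : ℝ, N = (n : ℝ) + 1 := ⟨_, rfl⟩
    have hNc : (n : ℂ) + 1 = (N : ℂ) := by rw [hNd]; push_cast; rfl
    rw [← hNd] at hN ⊢
    rw [hNc]
    set x := N ^ 2 * v with hx
    have hx0 : 0 < x := by positivity
    have hy : 4 * Real.pi * N ^ 2 * v = 4 * Real.pi * x := by rw [hx]; ring
    rw [hy]
    have hpi := Real.pi_gt_three
    have hy0 : 0 < 4 * Real.pi * x := by positivity
    have h1 := incGamma_bound (4 * Real.pi * x) hy0
    have h2 : ‖Complex.exp (2 * Real.pi * Complex.I * (-((N : ℂ) ^ 2)) * τ)‖ = Real.exp (2 * Real.pi * x) := by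
      rw [Complex.norm_exp]
      congr 1
      have : (2 * Real.pi * Complex.I * (-((N : ℂ) ^ 2)) * τ) = ((-(2 * Real.pi * N ^ 2) : ℝ) : ℂ) * (τ * Complex.I) := by
        push_cast; ring
      rw [this, Complex.re_ofReal_mul, Complex.mul_I_re, ← hvd, hx]; ring
    rw [norm_mul, norm_mul, h2, Complex.norm_real, Complex.norm_real, Real.norm_of_nonneg hN.le]
    have h3 : (4 * Real.pi * x) ^ (-(1 / 2) : ℝ) ≤ x ^ (-(1 / 2) : ℝ) :=
      Real.rpow_le_rpow_of_nonpos hx0 (by nlinarith) (by norm_num)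
    have h4 : Real.exp (-(4 * Real.pi * x)) * Real.exp (2 * Real.pi * x) ≤ x ^ (-(3 / 4) : ℝ) := by
      rw [← Real.exp_add]
      refine le_trans (Real.exp_le_exp.2 ?_) (exp_bound34 x hx0)
      nlinarith
    have h5 : N * (x ^ (-(1 / 2) : ℝ) * x ^ (-(3 / 4) : ℝ)) = v ^ (-(5 / 4) : ℝ) * N ^ (-(3 / 2) : ℝ) := by
      rw [← Real.rpow_add hx0, hx, Real.mul_rpow (by positivity) hv.le, ← Real.rpow_natCast, ← Real.rpow_mul hN.le]
      nth_rewrite 1 [← Real.rpow_one N]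
      rw [← mul_assoc, ← Real.rpow_add hN]
      norm_num
      ring
    have hxp : 0 ≤ x ^ (-(1 / 2) : ℝ) := Real.rpow_nonneg hx0.le _
    calc N * ‖incGamma (-(1 / 2)) (4 * Real.pi * x)‖ * Real.exp (2 * Real.pi * x)
        ≤ N * (2 * (4 * Real.pi * x) ^ (-(1 / 2) : ℝ) * Real.exp (-(4 * Real.pi * x))) * Real.exp (2 * Real.pi * x) := by gcongr
      _ = 2 * N * ((4 * Real.pi * x) ^ (-(1 / 2) : ℝ) * (Real.exp (-(4 * Real.pi * x)) * Real.exp (2 * Real.pi * x))) := by ring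
      _ ≤ 2 * N * (x ^ (-(1 / 2) : ℝ) * x ^ (-(3 / 4) : ℝ)) := by gcongr
      _ = 2 * (N * (x ^ (-(1 / 2) : ℝ) * x ^ (-(3 / 4) : ℝ))) := by ring
      _ = _ := by rw [h5]; ring
  have := tsum_of_norm_bounded (hsum.hasSum.mul_left (2 * v ^ (-(5 / 4) : ℝ))) hb
  exact this.trans (le_of_eq (by ring))

lemma cusp_main (h : ℤ) (k : ℕ) (hk : 0 < k) (hco : Int.gcd h k = 1) (k0 : ℕ) (hk0 : 0 < k0)
    (hk0' : ∀ a, k ∣ 4 * a ↔ k0 ∣ a) :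
    Tendsto (fun z : ℝ => ((z ^ ((3 : ℝ) / 2) : ℝ) : ℂ) * completedH ((h : ℂ) / k + Complex.I * z / k))
      (𝓝[>] (0 : ℝ)) (𝓝 (((1 / (48 * Real.sqrt 2) : ℝ) : ℂ) * ((Real.sqrt k : ℝ) : ℂ) * gG h k / k0)) := by
  obtain ⟨C1, hC10, hC1⟩ := genH
  obtain ⟨C2, hC2⟩ := str_lim h k hk hco k0 hk0 hk0'
  obtain ⟨C3, hC30, hC3⟩ := nonhol_bound
  have hkr : (0 : ℝ) < k := by exact_mod_cast hk
  have hkc : (k : ℂ) ≠ 0 := by exact_mod_cast hk.ne'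
  set μ : ℂ := gG h k / k with hμ
  let T : ℝ → ℝ := fun z => 2 * Real.pi / k * z
  let M : ℝ → ℝ := fun t => ∑' m : ℕ, mainf ((k0 * (m + 1) : ℕ) : ℝ) t
  have hc : 0 < 2 * Real.pi / k := by positivity
  have hTpos : ∀ z : ℝ, 0 < z → 0 < T z := fun z hz => mul_pos hc hz
  have hT0 : Tendsto T (𝓝[>] 0) (𝓝 0) := by
    have : Tendsto T (𝓝 0) (𝓝 (T 0)) := (by simp only [T]; fun_prop : Continuous T).tendsto 0
    simp only [T, mul_zero] at this
    exact this.mono_left nhdsWithin_le_nhds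
  -- main limit
  have hML : Tendsto (fun z => Real.sqrt (T z) * M (T z)) (𝓝[>] 0) (𝓝 (Real.sqrt Real.pi * Real.pi / (12 * k0))) := by
    rw [tendsto_iff_dist_tendsto_zero]
    have hs : Tendsto (fun z => Real.sqrt (T z)) (𝓝[>] 0) (𝓝 0) := by
      have := (Real.continuous_sqrt.tendsto 0).comp hT0
      rw [Real.sqrt_zero] at this
      exact this
    refine squeeze_zero' (Eventually.of_forall fun _ => dist_nonneg) ?_ hs
    filter_upwards [self_mem_nhdsWithin] with z hz
    exact (mainf_bound k0 hk0 (T z) (hTpos z hz)).2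
  let E : ℝ → ℂ := fun z => completedH ((h : ℂ) / k + Complex.I * z / k) - μ * ((1 / (2 * T z) * M (T z) : ℝ) : ℂ)
  have hE : ∃ C : ℝ, ∀ z : ℝ, 0 < z → z < 1 → ‖E z‖ ≤ C * z ^ (-(5 / 4) : ℝ) := by
    refine ⟨(C1 + C2) * (2 * Real.pi / k) ^ (-(5 / 4) : ℝ) + 1 + 1 / (8 * Real.pi) * Real.sqrt k
      + (1 / (4 * Real.sqrt Real.pi)) * (C3 * (1 / k : ℝ) ^ (-(5 / 4) : ℝ)), ?_⟩
    intro z hz hz1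
    set τ : ℂ := (h : ℂ) / k + Complex.I * z / k with hτ
    have him : τ.im = 1 / k * z := by
      have : τ = ((h / k : ℝ) : ℂ) + ((1 / k * z : ℝ) : ℂ) * Complex.I := by rw [hτ]; push_cast; ring
      rw [this, Complex.add_im, Complex.ofReal_im, Complex.im_ofReal_mul]; simp
    have him0 : 0 < τ.im := by rw [him]; positivity
    have hpow : ∀ n : ℕ, Complex.exp (2 * Real.pi * Complex.I * n * τ) = qq h k (T z) ^ n := by
      intro n
      rw [qq, ← Complex.exp_nat_mul]
      congr 1
      simp only [T]
      rw [hτ]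
      push_cast
      have := Complex.I_sq
      linear_combination (2 * Real.pi * n * z / k : ℂ) * this
    set t := T z with ht
    have ht0 : 0 < t := hTpos z hz
    set P := z ^ (-(5 / 4) : ℝ) with hP
    have hP1 : 1 ≤ P := Real.one_le_rpow_of_pos_of_le_one_of_nonpos hz hz1.le (by norm_num)
    have htP : t ^ (-(5 / 4) : ℝ) = (2 * Real.pi / k) ^ (-(5 / 4) : ℝ) * P := Real.mul_rpow hc.le hz.le
    have h1 := hC1 t (qq h k t) ht0 (qq_norm h k t)
    have h2 := hC2 t ht0
    have h3 := hC3 τ him0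
    have h4 : ‖((1 / (8 * Real.pi * Real.sqrt τ.im) : ℝ) : ℂ)‖ ≤ 1 / (8 * Real.pi) * Real.sqrt k * P := by
      rw [Complex.norm_real, Real.norm_of_nonneg (by positivity), him, one_div_mul_eq_div, Real.sqrt_div hz.le]
      have e : 1 / Real.sqrt z = z ^ (-(1 / 2) : ℝ) := by
        rw [Real.sqrt_eq_rpow, Real.rpow_neg hz.le, one_div]
      have e2 : z ^ (-(1 / 2) : ℝ) ≤ P := Real.rpow_le_rpow_of_exponent_ge hz hz1.le (by norm_num)
      have e3 : 1 / (8 * Real.pi * (Real.sqrt z / Real.sqrt k)) = 1 / (8 * Real.pi) * Real.sqrt k * (1 / Real.sqrt z) := by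
        have := (Real.sqrt_pos.2 hz).ne'
        have := (Real.sqrt_pos.2 hkr).ne'
        field_simp
      rw [e3, e]
      gcongr
    have hvP : τ.im ^ (-(5 / 4) : ℝ) = (1 / k : ℝ) ^ (-(5 / 4) : ℝ) * P := by
      rw [him]; exact Real.mul_rpow (by positivity) hz.le
    rw [hvP] at h3
    rw [htP] at h1 h2
    have eE : E z = ((∑' n : ℕ, (hurwitzClassNumber (n : ℤ) : ℂ) * qq h k t ^ n) - ∑' Q : Str, qq h k t ^ qD Q.1)
        + ((∑' Q : Str, qq h k t ^ qD Q.1) - μ * ((1 / (2 * t) * M t : ℝ) : ℂ))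
        + ((1 / (8 * Real.pi * Real.sqrt τ.im) : ℝ) : ℂ)
        + ((1 / (4 * Real.sqrt Real.pi) : ℝ) : ℂ) * ∑' n : ℕ, (((n : ℂ) + 1) *
        ((incGamma (-(1 / 2)) (4 * Real.pi * ((n : ℝ) + 1) ^ 2 * τ.im) : ℝ) : ℂ) *
        Complex.exp (2 * Real.pi * Complex.I * (-(((n : ℂ) + 1) ^ 2)) * τ)) := by
      simp only [E]
      rw [← hτ, completedH]
      simp only [hpow]
      rw [← ht]
      ring
    rw [eE]
    have h5 : ‖((1 / (4 * Real.sqrt Real.pi) : ℝ) : ℂ) * ∑' n : ℕ, (((n : ℂ) + 1) *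
        ((incGamma (-(1 / 2)) (4 * Real.pi * ((n : ℝ) + 1) ^ 2 * τ.im) : ℝ) : ℂ) *
        Complex.exp (2 * Real.pi * Complex.I * (-(((n : ℂ) + 1) ^ 2)) * τ))‖ ≤
        (1 / (4 * Real.sqrt Real.pi)) * (C3 * ((1 / k : ℝ) ^ (-(5 / 4) : ℝ) * P)) := by
      rw [norm_mul, Complex.norm_real, Real.norm_of_nonneg (by positivity)]
      gcongr
    refine (norm_add_le _ _).trans ?_
    refine (add_le_add (norm_add₃_le) h5).trans ?_
    refine (add_le_add (add_le_add (add_le_add h1 h2) h4) le_rfl).trans ?_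
    nlinarith
  have hEl : Tendsto (fun z : ℝ => ((z ^ ((3 : ℝ) / 2) : ℝ) : ℂ) * E z) (𝓝[>] 0) (𝓝 0) := by
    obtain ⟨C, hC⟩ := hE
    have hz4 : Tendsto (fun z : ℝ => C * z ^ ((1 : ℝ) / 4)) (𝓝[>] 0) (𝓝 0) := by
      have h1 : Tendsto (fun z : ℝ => C * z ^ ((1 : ℝ) / 4)) (𝓝 0) (𝓝 (C * (0 : ℝ) ^ ((1 : ℝ) / 4))) :=
        ((Real.continuous_rpow_const (by norm_num)).tendsto 0).const_mul C
      rw [Real.zero_rpow (by norm_num), mul_zero] at h1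
      exact h1.mono_left nhdsWithin_le_nhds
    refine squeeze_zero_norm' ?_ hz4
    filter_upwards [Ioo_mem_nhdsGT (show (0 : ℝ) < 1 by norm_num)] with z hz
    have h1 := hC z hz.1 hz.2
    have h3 : 0 ≤ z ^ ((3 : ℝ) / 2) := Real.rpow_nonneg hz.1.le _
    rw [norm_mul, Complex.norm_real, Real.norm_of_nonneg h3]
    refine (mul_le_mul_of_nonneg_left h1 h3).trans (le_of_eq ?_)
    rw [mul_left_comm, ← Real.rpow_add hz.1]
    norm_num
  have hMz : ∀ z : ℝ, 0 < z → z ^ ((3 : ℝ) / 2) * (1 / (2 * T z) * M (T z)) =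
      (k / (2 * Real.pi)) * Real.sqrt (k / (2 * Real.pi)) / 2 * (Real.sqrt (T z) * M (T z)) := by
    intro z hz
    have e1 : z ^ ((3 : ℝ) / 2) = z * Real.sqrt z := by
      rw [Real.sqrt_eq_rpow]
      nth_rewrite 2 [← Real.rpow_one z]
      rw [← Real.rpow_add hz]; norm_num
    have e2 : Real.sqrt z = Real.sqrt (k / (2 * Real.pi)) * Real.sqrt (T z) := by
      rw [← Real.sqrt_mul (by positivity)]
      congr 1
      simp only [T]
      field_simp
    have e3 : z = k / (2 * Real.pi) * T z := by simp only [T]; field_simp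
    have e4 : z * (1 / (2 * T z)) = k / (2 * Real.pi) / 2 := by
      nth_rewrite 1 [e3]
      have := (hTpos z hz).ne'
      field_simp
    rw [e1, show z * Real.sqrt z * (1 / (2 * T z) * M (T z)) = (z * (1 / (2 * T z))) * (Real.sqrt z * M (T z)) by ring,
      e4, e2]
    ring
  have hmain : Tendsto (fun z : ℝ => ((z ^ ((3 : ℝ) / 2) : ℝ) : ℂ) * (μ * ((1 / (2 * T z) * M (T z) : ℝ) : ℂ))) (𝓝[>] 0)
      (𝓝 (μ * (((k / (2 * Real.pi)) * Real.sqrt (k / (2 * Real.pi)) / 2 * (Real.sqrt Real.pi * Real.pi / (12 * k0)) : ℝ) : ℂ))) := by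
    have h1 := (Complex.continuous_ofReal.tendsto _).comp
      (hML.const_mul ((k / (2 * Real.pi)) * Real.sqrt (k / (2 * Real.pi)) / 2))
    refine (h1.const_mul μ).congr' ?_
    filter_upwards [self_mem_nhdsWithin] with z hz
    simp only [Function.comp]
    rw [← hMz z hz]; push_cast; ring
  have hfin := hmain.add hEl
  have econst : μ * (((k / (2 * Real.pi)) * Real.sqrt (k / (2 * Real.pi)) / 2 * (Real.sqrt Real.pi * Real.pi / (12 * k0)) : ℝ) : ℂ) + 0
      = ((1 / (48 * Real.sqrt 2) : ℝ) : ℂ) * ((Real.sqrt k : ℝ) : ℂ) * gG h k / k0 := by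
    have hk0r : (k0 : ℝ) ≠ 0 := by exact_mod_cast hk0.ne'
    have hk0c : (k0 : ℂ) ≠ 0 := by exact_mod_cast hk0.ne'
    have e1 : (k / (2 * Real.pi)) * Real.sqrt (k / (2 * Real.pi)) / 2 * (Real.sqrt Real.pi * Real.pi / (12 * k0))
        = k * (1 / (48 * Real.sqrt 2) * Real.sqrt k / k0) := by
      rw [Real.sqrt_div hkr.le, Real.sqrt_mul (by norm_num)]
      have h1 := (Real.sqrt_pos.2 Real.pi_pos).ne'
      have h2 := (Real.sqrt_pos.2 (show (0:ℝ) < 2 by norm_num)).ne'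
      have h3 := Real.pi_pos.ne'
      field_simp
      norm_num
    rw [e1, hμ, add_zero]
    push_cast
    field_simp
  rw [econst] at hfin
  refine hfin.congr' (Eventually.of_forall fun z => ?_)
  simp only [E]
  ring


end

/-- Lemma 2.4: for `gcd(h,k) = 1`,
`lim_{z→0⁺} z^{3/2} Ĥ(h/k + iz/k)` equals `(1/(48√2))(h/k)ε_k⁻¹` if `k` is odd,
`0` if `k ≡ 2 (mod 4)`, and `(e^{-πi/4}/12) ε_h (k/h)` if `4 ∣ k`. -/
theorem completedH_cusp_growth (h : ℤ) (k : ℕ) (hk : 0 < k) (hco : Int.gcd h k = 1) :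
    Filter.Tendsto
      (fun z : ℝ => ((z ^ ((3 : ℝ) / 2) : ℝ) : ℂ) *
        completedH ((h : ℂ) / k + Complex.I * z / k))
      (𝓝[>] (0 : ℝ))
      (𝓝 (if k % 2 = 1 then
            ((1 / (48 * Real.sqrt 2) : ℝ) : ℂ) * (jacobiSym h k : ℂ) * (eps (k : ℤ))⁻¹
          else if k % 4 = 2 then 0
          else Complex.exp (-(Real.pi * Complex.I) / 4) / 12 * eps h *
            (jacobiSym (k : ℤ) h.natAbs : ℂ))) := by
  have hkc : (k : ℂ) ≠ 0 := by exact_mod_cast hk.ne'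
  have hsq : ((Real.sqrt k : ℝ) : ℂ) * ((Real.sqrt k : ℝ) : ℂ) = k := by
    rw [← Complex.ofReal_mul, Real.mul_self_sqrt (Nat.cast_nonneg k)]; simp
  split_ifs with h1 h2
  · have h3 := cusp_main h k hk hco k hk (fun a => by
      have hc : Nat.Coprime k 4 := by
        rw [show 4 = 2 ^ 2 by norm_num]
        exact Nat.Coprime.pow_right 2 (Nat.coprime_two_right.2 (Nat.odd_iff.2 h1))
      exact hc.dvd_mul_left)
    rw [gG_odd h k h1 hco] at h3
    convert h3 using 2
    rw [eq_div_iff hkc]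
    linear_combination (-(((1 / (48 * Real.sqrt 2) : ℝ) : ℂ) * (jacobiSym h k : ℂ) * (eps (k : ℤ))⁻¹)) * hsq
  · obtain ⟨m, rfl⟩ : ∃ m, k = 2 * m := ⟨k / 2, by omega⟩
    have h3 := cusp_main h (2 * m) hk hco m (by omega) (fun a => by
      have hc : Nat.Coprime m 2 := Nat.coprime_two_right.2 (Nat.odd_iff.2 (by omega))
      rw [show 4 * a = 2 * (2 * a) by ring, Nat.mul_dvd_mul_iff_left (by norm_num)]
      exact hc.dvd_mul_left)
    rw [gG_two h (2 * m) (by omega) hco] at h3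
    simpa using h3
  · have h4 : k % 4 = 0 := by omega
    obtain ⟨m, hm⟩ : ∃ m, k = 4 * m := ⟨k / 4, by omega⟩
    have h3 := cusp_main h k hk hco m (by omega) (fun a => by
      rw [hm, Nat.mul_dvd_mul_iff_left (by norm_num)])
    rw [gG_four h k hk h4 hco] at h3
    convert h3 using 2
    have hmc : (m : ℂ) ≠ 0 := by
      have : m ≠ 0 := by omega
      exact_mod_cast this
    have h2c : ((Real.sqrt 2 : ℝ) : ℂ) ≠ 0 := by
      exact_mod_cast (Real.sqrt_pos.2 (show (0:ℝ) < 2 by norm_num)).ne'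
    have hk4 : (k : ℂ) = 4 * m := by rw [hm]; push_cast; ring
    rw [hk4] at hsq
    rw [eq_div_iff hmc]
    have e : ((1 / (48 * Real.sqrt 2) : ℝ) : ℂ) * ((Real.sqrt 2 : ℝ) : ℂ) = 1 / 48 := by
      push_cast; field_simp
    linear_combination (-(Complex.exp (-(Real.pi * Complex.I) / 4) * eps h * (jacobiSym (k : ℤ) h.natAbs : ℂ)) / 48) * hsq
      - (((Real.sqrt k : ℝ) : ℂ) * ((Real.sqrt k : ℝ) : ℂ) * Complex.exp (-(Real.pi * Complex.I) / 4) * eps h * (jacobiSym (k : ℤ) h.natAbs : ℂ)) * e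


end HurwitzPaper
end

section
/- Let h, m ∈ ℤ and M, k ∈ ℕ with gcd(h,k)=1. Then lim_{z→0⁺} √z·θ_{m,M}(h/k + iz/k) (z real positive) = (e^{2πi·hm²/k}/(M·√(2k)))·G(hM², 2hmM; k). -/
open scoped BigOperators Real

namespace HurwitzPaper

/-- The generalized quadratic Gauss sum `G(a,b;c) = ∑_{ℓ mod c} e^{2πi(aℓ² + bℓ)/c}`. -/
noncomputable def gaussSum' (a b : ℤ) (c : ℕ) : ℂ :=
  ∑ ℓ ∈ Finset.range c,
    Complex.exp (2 * Real.pi * Complex.I * ((a : ℂ) * (ℓ : ℂ) ^ 2 + (b : ℂ) * ℓ) / c)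

open scoped Topology

/-- The theta function `θ_{m,M}(τ) = ∑_{n ≡ m (mod M)} q^{n²}`, regarded as a function
of `τ ∈ ℂ` (with `q = e^{2πiτ}`). -/
noncomputable def theta (m : ℤ) (M : ℕ) (τ : ℂ) : ℂ :=
  ∑' n : ℤ, if n % (M : ℤ) = m % (M : ℤ) then
    Complex.exp (2 * Real.pi * Complex.I * ((n : ℂ) ^ 2) * τ) else 0

open HurwitzZeta in
lemma kernel_lim (s : ℝ) (c : ℝ) (hc : 0 < c) :
    Filter.Tendsto (fun z : ℝ => Real.sqrt z * evenKernel (s : UnitAddCircle) (c * z))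
      (𝓝[>] (0 : ℝ)) (𝓝 (1 / Real.sqrt c)) := by
  have h1 : Filter.Tendsto (cosKernel (s : UnitAddCircle)) Filter.atTop (𝓝 1) := by
    obtain ⟨p, hp, hO⟩ := isBigO_atTop_cosKernel_sub (s : UnitAddCircle)
    have h0 : Filter.Tendsto (fun x : ℝ => Real.exp (-p * x)) Filter.atTop (𝓝 0) := by
      apply Real.tendsto_exp_atBot.comp
      exact Filter.tendsto_id.const_mul_atTop_of_neg (by linarith)
    have := (hO.trans_tendsto h0).add_const 1
    simpa using this
  have h2 : Filter.Tendsto (fun z : ℝ => 1 / (c * z)) (𝓝[>] (0 : ℝ)) Filter.atTop := by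
    have := (tendsto_inv_nhdsGT_zero (𝕜 := ℝ)).const_mul_atTop (inv_pos.mpr hc)
    refine this.congr fun z => ?_
    simp [mul_comm]
  have h3 := (h1.comp h2).const_mul (1 / Real.sqrt c)
  rw [mul_one] at h3
  refine h3.congr' ?_
  filter_upwards [self_mem_nhdsWithin] with z hz
  have hz : 0 < z := hz
  have hsz : Real.sqrt z ≠ 0 := (Real.sqrt_pos.mpr hz).ne'
  have hsc : Real.sqrt c ≠ 0 := (Real.sqrt_pos.mpr hc).ne'
  rw [evenKernel_functional_equation, ← Real.sqrt_eq_rpow, Real.sqrt_mul hc.le]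
  simp only [Function.comp]
  field_simp

lemma exp_split (h m : ℤ) (M k : ℕ) (hM : 0 < M) (hk : 0 < k) (z : ℝ) (l : ℕ) (n : ℤ) :
    Complex.exp (2 * Real.pi * Complex.I * (((m + M * l + M * k * n : ℤ) : ℂ) ^ 2) *
        ((h : ℂ) / k + Complex.I * z / k)) =
    Complex.exp (2 * Real.pi * Complex.I * (h : ℂ) * ((m : ℂ) + M * l) ^ 2 / k) *
      ((Real.exp (-Real.pi * (n + ((m + M * l : ℝ) / (M * k))) ^ 2 * (2 * M ^ 2 * k * z)) : ℝ) : ℂ)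
      := by
  have hM' : (M : ℂ) ≠ 0 := by exact_mod_cast hM.ne'
  have hk' : (k : ℂ) ≠ 0 := by exact_mod_cast hk.ne'
  push_cast
  rw [← Complex.exp_add, Complex.exp_eq_exp_iff_exists_int]
  refine ⟨h * (2 * (m + M * l) * M * n + M ^ 2 * k * n ^ 2), ?_⟩
  push_cast
  field_simp
  ring_nf
  simp only [Complex.I_sq]
  ring

open HurwitzZeta in
lemma theta_eq (h m : ℤ) (M k : ℕ) (hM : 0 < M) (hk : 0 < k) (z : ℝ) (hz : 0 < z) :
    theta m M ((h : ℂ) / k + Complex.I * z / k) =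
      ∑ l ∈ Finset.range k,
        Complex.exp (2 * Real.pi * Complex.I * (h : ℂ) * ((m : ℂ) + M * l) ^ 2 / k) *
        ((evenKernel (((m + M * l : ℝ) / (M * k) : ℝ) : UnitAddCircle) (2 * M ^ 2 * k * z) : ℝ)
          : ℂ) := by
  have hMz : (M : ℤ) ≠ 0 := by exact_mod_cast hM.ne'
  have hkz : (k : ℤ) ≠ 0 := by exact_mod_cast hk.ne'
  have hMr : (0 : ℝ) < M := by exact_mod_cast hM
  have hkr : (0 : ℝ) < k := by exact_mod_cast hk
  set F : ℤ → ℂ := fun n => Complex.exp (2 * Real.pi * Complex.I * ((n : ℂ) ^ 2) *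
        ((h : ℂ) / k + Complex.I * z / k)) with hF
  have key : ∀ l ∈ Finset.range k, HasSum
      (fun n : ℤ => if (M * k : ℤ) ∣ n - (m + M * l) then F n else 0)
      (Complex.exp (2 * Real.pi * Complex.I * (h : ℂ) * ((m : ℂ) + M * l) ^ 2 / k) *
        ((evenKernel (((m + M * l : ℝ) / (M * k) : ℝ) : UnitAddCircle) (2 * M ^ 2 * k * z) : ℝ)
          : ℂ)) := by
    intro l _
    have hinj : Function.Injective (fun n : ℤ => m + M * l + M * k * n) := by
      intro a b hab
      simpa [hMz, hkz, hM.ne', hk.ne'] using hab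
    rw [← hinj.hasSum_iff]
    · have := (Complex.hasSum_ofReal.mpr (hasSum_int_evenKernel ((m + M * l : ℝ) / (M * k))
        (t := 2 * M ^ 2 * k * z) (by positivity))).mul_left
        (Complex.exp (2 * Real.pi * Complex.I * (h : ℂ) * ((m : ℂ) + M * l) ^ 2 / k))
      convert! this using 1
      funext n
      rw [← exp_split h m M k hM hk z l n]
      simp [hF]
    · intro x hx
      rw [if_neg]
      rintro ⟨c, hc⟩
      exact hx ⟨c, by simp only; linarith⟩
  have tot := hasSum_sum key
  rw [← tot.tsum_eq, theta]
  refine tsum_congr fun n => ?_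
  split_ifs with hn
  · have hd : (M : ℤ) ∣ n - m := Int.ModEq.dvd (Eq.symm hn)
    obtain ⟨j, hj⟩ := hd
    have hj0 := Int.emod_nonneg j hkz
    have hjk := Int.emod_lt_of_pos j (b := (k : ℤ)) (by omega)
    have hcond : ∀ l : ℕ, ((M * k : ℤ) ∣ n - (m + M * l)) ↔ (k : ℤ) ∣ j - l := by
      intro l
      rw [show n - (m + M * l) = M * (j - l) by linarith]
      exact mul_dvd_mul_iff_left hMz
    rw [Finset.sum_eq_single (j % k).toNat]
    · rw [if_pos]
      rw [hcond, Int.toNat_of_nonneg hj0]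
      exact Int.dvd_self_sub_emod
    · intro l hl hne
      rw [if_neg]
      rw [hcond]
      intro hdv
      apply hne
      have h1 : j % k = (l : ℤ) % k := 
        Int.emod_eq_emod_iff_emod_sub_eq_zero.mpr (Int.emod_eq_zero_of_dvd hdv)
      have h2 : (l : ℤ) % k = l := Int.emod_eq_of_lt (by omega) (by have := Finset.mem_range.mp hl; omega)
      omega
    · intro hnot
      exfalso
      apply hnot
      rw [Finset.mem_range]
      omega
  · symm
    apply Finset.sum_eq_zero
    intro l _
    rw [if_neg]
    intro hdv
    apply hn
    have h1 : (M : ℤ) ∣ n - m := by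
      have := (Dvd.intro _ rfl : (M : ℤ) ∣ M * k).trans hdv
      have h2 : n - m = (n - (m + M * l)) + M * l := by ring
      rw [h2]
      exact dvd_add this (Dvd.intro _ rfl)
    exact Int.emod_eq_emod_iff_emod_sub_eq_zero.mpr (Int.emod_eq_zero_of_dvd h1)

/-- Lemma 2.5: for `gcd(h,k) = 1`,
`lim_{z→0⁺} √z · θ_{m,M}(h/k + iz/k) = (e^{2πi h m²/k}/(M√(2k))) G(hM², 2hmM; k)`. -/
theorem theta_cusp_growth (h m : ℤ) (M k : ℕ) (hM : 0 < M) (hk : 0 < k)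
    (hco : Int.gcd h k = 1) :
    Filter.Tendsto
      (fun z : ℝ => ((Real.sqrt z : ℝ) : ℂ) * theta m M ((h : ℂ) / k + Complex.I * z / k))
      (𝓝[>] (0 : ℝ))
      (𝓝 (Complex.exp (2 * Real.pi * Complex.I * (h : ℂ) * (m : ℂ) ^ 2 / k) /
          ((M : ℂ) * ((Real.sqrt (2 * k) : ℝ) : ℂ)) *
        gaussSum' (h * (M : ℤ) ^ 2) (2 * h * m * M) k)) := by
  have hMc : (M : ℂ) ≠ 0 := by exact_mod_cast hM.ne'
  have hkc : (k : ℂ) ≠ 0 := by exact_mod_cast hk.ne'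
  have hMr : (0 : ℝ) < M := by exact_mod_cast hM
  have hkr : (0 : ℝ) < k := by exact_mod_cast hk
  have hs : Real.sqrt (2 * M ^ 2 * k) = M * Real.sqrt (2 * k) := by
    rw [show (2 * M ^ 2 * k : ℝ) = M ^ 2 * (2 * k) by ring, Real.sqrt_mul (by positivity),
      Real.sqrt_sq hMr.le]
  have L : Filter.Tendsto (fun z : ℝ => ∑ l ∈ Finset.range k,
        Complex.exp (2 * Real.pi * Complex.I * (h : ℂ) * ((m : ℂ) + M * l) ^ 2 / k) *
        ((Real.sqrt z * HurwitzZeta.evenKernel (((m + M * l : ℝ) / (M * k) : ℝ) : UnitAddCircle)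
          (2 * M ^ 2 * k * z) : ℝ) : ℂ)) (𝓝[>] (0 : ℝ))
      (𝓝 (∑ l ∈ Finset.range k,
        Complex.exp (2 * Real.pi * Complex.I * (h : ℂ) * ((m : ℂ) + M * l) ^ 2 / k) *
        ((1 / Real.sqrt (2 * M ^ 2 * k) : ℝ) : ℂ))) := by
    apply tendsto_finsetSum
    intro l _
    apply Filter.Tendsto.const_mul
    exact (Complex.continuous_ofReal.tendsto _).comp (kernel_lim _ _ (by positivity))
  have hval : (∑ l ∈ Finset.range k,
        Complex.exp (2 * Real.pi * Complex.I * (h : ℂ) * ((m : ℂ) + M * l) ^ 2 / k) *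
        ((1 / Real.sqrt (2 * M ^ 2 * k) : ℝ) : ℂ)) =
      (Complex.exp (2 * Real.pi * Complex.I * (h : ℂ) * (m : ℂ) ^ 2 / k) /
          ((M : ℂ) * ((Real.sqrt (2 * k) : ℝ) : ℂ)) *
        gaussSum' (h * (M : ℤ) ^ 2) (2 * h * m * M) k) := by
    rw [gaussSum', Finset.mul_sum]
    refine Finset.sum_congr rfl fun l _ => ?_
    rw [hs, div_mul_eq_mul_div, ← Complex.exp_add]
    push_cast
    rw [mul_one_div]
    congr 2
    field_simp
    ring
  rw [← hval]
  refine L.congr' ?_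
  filter_upwards [self_mem_nhdsWithin] with z hz
  rw [theta_eq h m M k hM hk z hz, Finset.mul_sum]
  refine Finset.sum_congr rfl fun l _ => ?_
  push_cast
  ring

end HurwitzPaper
end

section
/- For every n ∈ ℕ, λ_{1,0,3}(12n) = 12·δ_{3∣n}·∑_{d∣(n/3), d²<n/3} d + δ_{12n=□}·√(12n). -/
open scoped BigOperators

namespace HurwitzPaper

/-- `λ_{ℓ,m,M}(n) = ∑_{ε ∈ {+1,-1}} ∑*_{0 ≤ s < t, t²-s²=n, t ≡ εm (mod M)} (t-s)^ℓ`,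
where the terms with `s = 0` are weighted by `1/2`, and the two sign choices `ε` are
summed separately even when they impose the same congruence condition. -/
noncomputable def lam (ℓ : ℕ) (m : ℤ) (M : ℕ) (n : ℕ) : ℝ :=
  ∑ ε ∈ ({1, -1} : Finset ℤ),
    ∑ᶠ p : ℤ × ℤ,
      if 0 ≤ p.1 ∧ p.1 < p.2 ∧ p.2 ^ 2 - p.1 ^ 2 = (n : ℤ) ∧
          p.2 % (M : ℤ) = (ε * m) % (M : ℤ) then
        (if p.1 = 0 then (1 : ℝ) / 2 else 1) * ((p.2 - p.1 : ℤ) : ℝ) ^ ℓ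
      else 0

lemma key (m : ℕ) (hm : 0 < m) :
    (∑ᶠ p : ℤ × ℤ, if 0 ≤ p.1 ∧ p.1 < p.2 ∧ p.2 ^ 2 - p.1 ^ 2 = 36 * (m : ℤ) ∧ p.2 % 3 = 0 then
        (if p.1 = 0 then (1 : ℝ) / 2 else 1) * ((p.2 - p.1 : ℤ) : ℝ) else 0) =
    ∑ d ∈ m.divisors.filter (fun d => d ^ 2 ≤ m),
      (if d ^ 2 = m then (1 : ℝ) / 2 else 1) * (6 * (d : ℝ)) := by
  classical
  let g : ℕ → ℤ × ℤ := fun d => (3 * (((m / d : ℕ) : ℤ) - d), 3 * (((m / d : ℕ) : ℤ) + d))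
  rw [finsum_eq_finsetSum_of_support_subset
    (s := (m.divisors.filter (fun d => d ^ 2 ≤ m)).image g)]
  · rw [Finset.sum_image]
    · apply Finset.sum_congr rfl
      intro d hd
      simp only [Finset.mem_filter, Nat.mem_divisors] at hd
      obtain ⟨⟨⟨e, rfl⟩, h0⟩, h1⟩ := hd
      have hd0 : 0 < d := Nat.pos_of_ne_zero (by rintro rfl; simp at h0)
      have he : d * e / d = e := Nat.mul_div_cancel_left e hd0
      have hde : d ≤ e := by nlinarith
      simp only [g, he]
      rw [if_pos]
      · have : (3 * ((e : ℤ) - d) = 0) ↔ d ^ 2 = d * e := by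
          rw [sq, Nat.mul_right_inj hd0.ne']
          omega
        simp only [this]
        push_cast
        ring
      · refine ⟨by omega, by omega, by push_cast; ring, by omega⟩
    · intro a _ b _ hab
      simp only [g, Prod.mk.injEq] at hab
      omega
  · rintro ⟨s, t⟩ hp
    rw [Function.mem_support] at hp
    have hc := (ne_eq _ _ ▸ hp : ¬ _)
    by_cases hC : 0 ≤ s ∧ s < t ∧ t ^ 2 - s ^ 2 = 36 * (m : ℤ) ∧ t % 3 = 0
    · obtain ⟨h0, h1, h2, h3⟩ := hC
      obtain ⟨u, rfl⟩ := Int.dvd_of_emod_eq_zero h3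
      have h3s : (3 : ℤ) ∣ s := by
        apply Int.prime_three.dvd_of_dvd_pow (n := 2)
        exact ⟨3 * u ^ 2 - 12 * m, by linarith⟩
      obtain ⟨v, rfl⟩ := h3s
      have h4 : (u - v) * (u + v) = 4 * m := by nlinarith
      have h5 : (2 : ℤ) ∣ u - v := by
        have : (2 : ℤ) ∣ (u - v) * (u + v) := ⟨2 * m, by linarith⟩
        rcases Int.prime_two.dvd_or_dvd this with h | h <;> omega
      obtain ⟨a, ha⟩ := h5
      have hu : u = v + 2 * a := by linarith
      subst hu
      have h6 : a * (a + v) = m := by nlinarith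
      lift a to ℕ using by omega
      lift v to ℕ using by omega
      have h7 : a * (a + v) = m := by exact_mod_cast h6
      have ha0 : 0 < a := by omega
      rw [Finset.mem_coe, Finset.mem_image]
      refine ⟨a, ?_, ?_⟩
      · rw [Finset.mem_filter, Nat.mem_divisors]
        exact ⟨⟨⟨_, h7.symm⟩, hm.ne'⟩, by nlinarith⟩
      · have : m / a = a + v := by rw [← h7]; exact Nat.mul_div_cancel_left _ ha0
        simp only [g, this, Prod.mk.injEq]
        push_cast
        constructor <;> ring
    · exact absurd (if_neg hC) hp

lemma split (m : ℕ) (hm : 0 < m) :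
    2 * ∑ d ∈ m.divisors.filter (fun d => d ^ 2 ≤ m),
      (if d ^ 2 = m then (1 : ℝ) / 2 else 1) * (6 * (d : ℝ)) =
    12 * ∑ d ∈ m.divisors.filter (fun d => d ^ 2 < m), (d : ℝ) +
      (if IsSquare (36 * m) then (1 : ℝ) else 0) * Real.sqrt (36 * m) := by
  have h1 : ∑ d ∈ m.divisors.filter (fun d => d ^ 2 ≤ m),
      (if d ^ 2 = m then (1 : ℝ) / 2 else 1) * (6 * (d : ℝ)) =
      ∑ d ∈ m.divisors.filter (fun d => d ^ 2 < m), 6 * (d : ℝ) +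
      ∑ d ∈ m.divisors.filter (fun d => d ^ 2 = m), 3 * (d : ℝ) := by
    simp only [Finset.sum_filter]
    rw [← Finset.sum_add_distrib]
    apply Finset.sum_congr rfl
    intro d _
    rcases lt_trichotomy (d ^ 2) m with h | h | h
    · simp [h, h.le, h.ne]
    · simp [h]; ring
    · simp [h.not_gt, h.not_ge, h.ne']
  have h2 : ∑ d ∈ m.divisors.filter (fun d => d ^ 2 = m), 6 * (d : ℝ) =
      (if IsSquare (36 * m) then (1 : ℝ) else 0) * Real.sqrt (36 * m) := by
    split_ifs with h
    · obtain ⟨r, hr⟩ := h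
      have h6 : 6 ∣ r := by
        rw [← Nat.pow_dvd_pow_iff (n := 2) (by norm_num)]
        exact ⟨m, by nlinarith⟩
      obtain ⟨k, rfl⟩ := h6
      have hk : k ^ 2 = m := by nlinarith
      have : m.divisors.filter (fun d => d ^ 2 = m) = {k} := by
        ext d
        simp only [Finset.mem_filter, Nat.mem_divisors, Finset.mem_singleton]
        constructor
        · rintro ⟨_, h⟩
          exact Nat.pow_left_injective (n := 2) (by norm_num) (h.trans hk.symm)
        · rintro rfl
          exact ⟨⟨⟨d, by rw [← hk, sq]⟩, hm.ne'⟩, hk⟩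
      rw [this, Finset.sum_singleton, one_mul]
      symm
      rw [Real.sqrt_eq_iff_mul_self_eq (by positivity) (by positivity), ← hk]
      push_cast
      ring
    · rw [zero_mul]
      apply Finset.sum_eq_zero
      intro d hd
      rw [Finset.mem_filter] at hd
      exact absurd ⟨6 * d, by rw [← hd.2]; ring⟩ h
  rw [h1, ← h2, mul_add, Finset.mul_sum, Finset.mul_sum, Finset.mul_sum]
  congr 1 <;> (apply Finset.sum_congr rfl; intros; ring)

/-- the evaluation of `λ_{1,0,3}(12n)` from the proof of Lemma 4.1 (3):
`λ_{1,0,3}(12n) = 12 δ_{3∣n} ∑_{d∣(n/3), d²<n/3} d + δ_{12n=□} √(12n)`. -/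
theorem lambda_one_zero_three_twelve (n : ℕ) (hn : 0 < n) :
    lam 1 0 3 (12 * n) =
      12 * (if 3 ∣ n then (1 : ℝ) else 0) *
          (∑ d ∈ (n / 3).divisors.filter (fun d => d ^ 2 < n / 3), (d : ℝ))
      + (if IsSquare (12 * n) then (1 : ℝ) else 0) * Real.sqrt (12 * n) := by
  have hl : lam 1 0 3 (12 * n) = 2 * ∑ᶠ p : ℤ × ℤ,
      if 0 ≤ p.1 ∧ p.1 < p.2 ∧ p.2 ^ 2 - p.1 ^ 2 = 12 * (n : ℤ) ∧ p.2 % 3 = 0 then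
        (if p.1 = 0 then (1 : ℝ) / 2 else 1) * ((p.2 - p.1 : ℤ) : ℝ) else 0 := by
    unfold lam
    rw [Finset.sum_pair (by norm_num), two_mul]
    simp
  rw [hl]
  by_cases h3 : 3 ∣ n
  · obtain ⟨m, rfl⟩ := h3
    have hm : 0 < m := by omega
    have e1 : (12 : ℤ) * ((3 * m : ℕ) : ℤ) = 36 * (m : ℤ) := by push_cast; ring
    have e2 : 12 * (3 * m) = 36 * m := by ring
    have e3 : (12 : ℝ) * ((3 * m : ℕ) : ℝ) = 36 * (m : ℝ) := by push_cast; ring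
    have e4 : 3 * m / 3 = m := by omega
    rw [e1, e2, e3, e4, key m hm, split m hm, if_pos (dvd_mul_right 3 m), mul_one]
  · have hs : ¬ IsSquare (12 * n) := by
      rintro ⟨r, hr⟩
      have : 3 ∣ r := by
        apply Nat.prime_three.dvd_of_dvd_pow (n := 2)
        exact ⟨4 * n, by nlinarith⟩
      obtain ⟨k, rfl⟩ := this
      exact h3 (by
        have : 4 * n = 3 * (k * k) := by nlinarith
        omega)
    rw [if_neg h3, if_neg hs]
    have : ∀ p : ℤ × ℤ, (if 0 ≤ p.1 ∧ p.1 < p.2 ∧ p.2 ^ 2 - p.1 ^ 2 = 12 * (n : ℤ) ∧ p.2 % 3 = 0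
        then (if p.1 = 0 then (1 : ℝ) / 2 else 1) * ((p.2 - p.1 : ℤ) : ℝ) else 0) = 0 := by
      rintro ⟨s, t⟩
      apply if_neg
      rintro ⟨_, _, h2, ht⟩
      obtain ⟨u, hu⟩ := Int.dvd_of_emod_eq_zero ht
      simp only at h2 hu
      subst hu
      have h3s : (3 : ℤ) ∣ s := by
        apply Int.prime_three.dvd_of_dvd_pow (n := 2)
        exact ⟨3 * u ^ 2 - 4 * n, by linarith⟩
      obtain ⟨v, rfl⟩ := h3s
      have : 4 * (n : ℤ) = 3 * (u ^ 2 - v ^ 2) := by nlinarith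
      omega
    simp only [this]
    simp

end HurwitzPaper
end
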